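/- arXiv:1106.3421 — 13 statements merged into one kernel-verified Lean document; each statement's English description precedes it below -/
import Mathlib

section
/- Let S = [i, i+(s−1)] be an interval of s positive integers with i < s, and let x ∈ S. Then r(S \ {x}) = (s−i)(s−i+1)/2 − max(x − 2i + 1, 0) − max(2(s − x), 0) + ε, where ε = 1 if x ≤ (i + (s−1))/2 and ε = 0 if x > (i + (s−1))/2. Moreover if i ≥ s, then r(S \ {x}) = 0. -/
/-- `r(S)`: the number of ordered pairs `(x,y) ∈ S × S` with `x + y ∈ S`. -/
def rval (S : Finset ℕ) : ℕ :=
  ((S ×ˢ S).filter (fun p => p.1 + p.2 ∈ S)).card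

theorem rval_eq_sum (S : Finset ℕ) :
    rval S = ∑ a ∈ S, (S.filter (fun b => a + b ∈ S)).card := by
  simp only [rval, Finset.card_filter, Finset.sum_product]

theorem two_mul_sum_range_tsub (c m : ℕ) (h : c ≤ m) :
    2 * ∑ k ∈ Finset.range m, (c - k) = c * (c + 1) := by
  induction c generalizing m with
  | zero => simp
  | succ c ih =>
    obtain ⟨m, rfl⟩ : ∃ n, m = n + 1 := ⟨m - 1, by omega⟩
    rw [Finset.sum_range_succ']
    simp only [Nat.add_sub_add_right, Nat.sub_zero]
    rw [mul_add, ih m (by omega)]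
    ring

theorem two_mul_rval_Icc (i s : ℕ) (hi : 0 < i) (hs : 0 < s) :
    2 * rval (Finset.Icc i (i + s - 1)) = (s - i) * (s - i + 1) := by
  have hfib : ∀ a ∈ Finset.Icc i (i + s - 1),
      ((Finset.Icc i (i + s - 1)).filter
        (fun b => a + b ∈ Finset.Icc i (i + s - 1))).card = s - a := by
    intro a ha
    have : (Finset.Icc i (i + s - 1)).filter (fun b => a + b ∈ Finset.Icc i (i + s - 1))
        = Finset.Ico i (i + s - a) := by
      ext b
      simp only [Finset.mem_filter, Finset.mem_Icc, Finset.mem_Ico] at ha ⊢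
      omega
    rw [this, Nat.card_Ico]
    omega
  rw [rval_eq_sum, Finset.sum_congr rfl hfib]
  have hIco : Finset.Icc i (i + s - 1) = Finset.Ico i (i + s) := by
    ext b
    simp only [Finset.mem_Icc, Finset.mem_Ico]
    omega
  rw [hIco, Finset.sum_Ico_eq_sum_range, Nat.add_sub_cancel_left]
  simp only [Nat.sub_add_eq]
  exact two_mul_sum_range_tsub (s - i) s (Nat.sub_le s i)

/-- The pairs counted by `rval S` but not by `rval (S.erase x)` are those with sum `x` and those
with an entry equal to `x`; as `0 ∉ S`, no pair is of both types. -/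
theorem rval_erase_add (S : Finset ℕ) (x : ℕ) (hS : 0 ∉ S) (hx : x ∈ S) :
    rval (S.erase x) + (S.filter (fun a => a ≤ x ∧ x - a ∈ S)).card
        + 2 * (S.filter (fun b => x + b ∈ S)).card
      = rval S + if 2 * x ∈ S then 1 else 0 := by
  have hpos : ∀ a ∈ S, 0 < a := fun a ha => Nat.pos_of_ne_zero fun h => hS (h ▸ ha)
  set A := (S ×ˢ S).filter (fun p => p.1 + p.2 ∈ S) with hA
  have hE : ((S.erase x) ×ˢ (S.erase x)).filter (fun p => p.1 + p.2 ∈ S.erase x)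
      = A.filter (fun p => ¬ (p.1 + p.2 = x ∨ (p.1 = x ∨ p.2 = x))) := by
    ext p
    simp only [hA, Finset.mem_filter, Finset.mem_product, Finset.mem_erase]
    tauto
  have hC : (A.filter (fun p => p.1 + p.2 = x)).card
      = (S.filter (fun a => a ≤ x ∧ x - a ∈ S)).card := by
    refine Finset.card_nbij' (fun p => p.1) (fun a => (a, x - a)) ?_ ?_ ?_ ?_
    · rintro ⟨a, b⟩ h
      simp only [hA, Finset.coe_filter, Finset.mem_filter, Finset.mem_product,
        Set.mem_ofPred_eq] at h ⊢
      obtain ⟨⟨⟨ha, hb⟩, -⟩, rfl⟩ := h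
      simp [ha, hb]
    · intro a h
      simp only [hA, Finset.coe_filter, Finset.mem_filter, Finset.mem_product,
        Set.mem_ofPred_eq] at h ⊢
      obtain ⟨ha, hle, hb⟩ := h
      simp [ha, hb, hx, Nat.add_sub_cancel' hle]
    · rintro ⟨a, b⟩ h
      simp only [Finset.coe_filter, Set.mem_ofPred_eq] at h
      simp only [Prod.mk.injEq, true_and]
      omega
    · intro a _
      rfl
  have hL : A.filter (fun p => p.1 = x)
      = (S.filter (fun b => x + b ∈ S)).image (fun b => (x, b)) := by
    ext ⟨a, b⟩
    simp only [hA, Finset.mem_filter, Finset.mem_product, Finset.mem_image, Prod.mk.injEq]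
    grind
  have hR : A.filter (fun p => p.2 = x)
      = (S.filter (fun b => x + b ∈ S)).image (fun b => (b, x)) := by
    ext ⟨a, b⟩
    simp only [hA, Finset.mem_filter, Finset.mem_product, Finset.mem_image, Prod.mk.injEq]
    grind
  have hLR : (A.filter (fun p => p.1 = x) ∩ A.filter (fun p => p.2 = x)).card
      = if 2 * x ∈ S then 1 else 0 := by
    split_ifs with h
    · rw [Finset.card_eq_one]
      refine ⟨(x, x), ?_⟩
      ext ⟨a, b⟩
      simp only [hA, Finset.mem_inter, Finset.mem_filter, Finset.mem_product,
        Finset.mem_singleton, Prod.mk.injEq]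
      grind
    · rw [Finset.card_eq_zero, Finset.eq_empty_iff_forall_notMem]
      rintro ⟨a, b⟩
      simp only [hA, Finset.mem_inter, Finset.mem_filter, Finset.mem_product]
      grind
  have hdisj : Disjoint (A.filter (fun p => p.1 + p.2 = x))
      (A.filter (fun p => p.1 = x ∨ p.2 = x)) := by
    rw [Finset.disjoint_filter]
    rintro ⟨a, b⟩ h
    simp only [hA, Finset.mem_filter, Finset.mem_product] at h
    have := hpos a h.1.1
    have := hpos b h.1.2
    omega
  have hsplit := A.card_filter_add_card_filter_not
    (fun p => p.1 + p.2 = x ∨ (p.1 = x ∨ p.2 = x))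
  rw [Finset.filter_or, Finset.card_union_of_disjoint hdisj, ← hE, hC, Finset.filter_or] at hsplit
  have hunion := Finset.card_union_add_card_inter
    (A.filter (fun p => p.1 = x)) (A.filter (fun p => p.2 = x))
  rw [hLR] at hunion
  have hLc : (A.filter (fun p => p.1 = x)).card = (S.filter (fun b => x + b ∈ S)).card := by
    rw [hL, Finset.card_image_of_injective _ (Prod.mk_right_injective x)]
  have hRc : (A.filter (fun p => p.2 = x)).card = (S.filter (fun b => x + b ∈ S)).card := by
    rw [hR, Finset.card_image_of_injective _ (Prod.mk_left_injective x)]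
  simp only [rval, ← hA]
  omega

/-- Lemma 2.7: for the interval `S = [i, i+(s-1)]` and `x ∈ S`, a formula for
`r(S \ {x})` when `i < s`, and `r(S \ {x}) = 0` when `i ≥ s`. -/
theorem rval_interval_erase (i s x : ℕ) (hi : 0 < i) (hs : 0 < s)
    (hx : x ∈ Finset.Icc i (i + s - 1)) :
    (i < s →
      (rval ((Finset.Icc i (i + s - 1)).erase x) : ℤ) =
        ((s : ℤ) - i) * ((s : ℤ) - i + 1) / 2
          - max ((x : ℤ) - 2 * i + 1) 0 - max (2 * ((s : ℤ) - x)) 0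
          + (if 2 * x ≤ i + (s - 1) then (1 : ℤ) else 0)) ∧
    (s ≤ i → rval ((Finset.Icc i (i + s - 1)).erase x) = 0) := by
  have herase := rval_erase_add (Finset.Icc i (i + s - 1)) x (by simp; omega) hx
  have hfull := two_mul_rval_Icc i s hi hs
  have hsum : (Finset.Icc i (i + s - 1)).filter
      (fun a => a ≤ x ∧ x - a ∈ Finset.Icc i (i + s - 1)) = Finset.Ico i (x + 1 - i) := by
    ext a
    simp only [Finset.mem_filter, Finset.mem_Icc, Finset.mem_Ico] at hx ⊢
    omega
  have hentry : (Finset.Icc i (i + s - 1)).filter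
      (fun b => x + b ∈ Finset.Icc i (i + s - 1)) = Finset.Ico i (i + s - x) := by
    ext b
    simp only [Finset.mem_filter, Finset.mem_Icc, Finset.mem_Ico] at hx ⊢
    omega
  rw [hsum, hentry, Nat.card_Ico, Nat.card_Ico] at herase
  simp only [Finset.mem_Icc] at hx herase
  constructor
  · intro his
    have hhalf : ((s : ℤ) - i) * ((s : ℤ) - i + 1) / 2
        = (rval (Finset.Icc i (i + s - 1)) : ℤ) := by
      zify [his.le] at hfull
      rw [← hfull]
      exact Int.mul_ediv_cancel_left _ two_ne_zero
    rw [hhalf]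
    split_ifs at herase ⊢ <;> omega
  · intro hsi
    rw [Nat.sub_eq_zero_of_le hsi, zero_mul] at hfull
    split_ifs at herase <;> omega
end

section
/- Let N be a positive integer and 1 ≤ s ≤ N. The maximum value of r(S) over all subsets S ⊆ [1,N] with |S| = s equals s(s−1)/2. -/
/-- A finite set of `n` elements of a linear order has `n(n-1)/2` pairs `a < b`. -/
theorem Finset.card_filter_fst_lt_snd {α : Type*} [LinearOrder α] (S : Finset α) :
    ((S ×ˢ S).filter (fun p => p.1 < p.2)).card = S.card * (S.card - 1) / 2 := by
  have hswap : (S.offDiag.filter (fun p => ¬ p.1 < p.2)).card =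
      (S.offDiag.filter (fun p => p.1 < p.2)).card := by
    refine Finset.card_bij' (fun p _ => p.swap) (fun p _ => p.swap) ?_ ?_ ?_ ?_
    · rintro ⟨a, b⟩ h
      simp only [Finset.mem_filter, Finset.mem_offDiag, not_lt, Prod.swap] at h ⊢
      exact ⟨⟨h.1.2.1, h.1.1, h.1.2.2.symm⟩, lt_of_le_of_ne h.2 h.1.2.2.symm⟩
    · rintro ⟨a, b⟩ h
      simp only [Finset.mem_filter, Finset.mem_offDiag, not_lt, Prod.swap] at h ⊢
      exact ⟨⟨h.1.2.1, h.1.1, h.1.2.2.symm⟩, h.2.le⟩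
    · simp
    · simp
  have hlt : (S ×ˢ S).filter (fun p => p.1 < p.2) = S.offDiag.filter (fun p => p.1 < p.2) := by
    ext ⟨a, b⟩
    simp only [Finset.mem_filter, Finset.mem_product, Finset.mem_offDiag]
    exact ⟨fun h => ⟨⟨h.1.1, h.1.2, h.2.ne⟩, h.2⟩, fun h => ⟨⟨h.1.1, h.1.2.1⟩, h.2⟩⟩
  have hsum := Finset.card_filter_add_card_filter_not (s := S.offDiag) (fun p => p.1 < p.2)
  rw [hswap, Finset.offDiag_card, ← Nat.mul_sub_one] at hsum
  rw [hlt]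
  omega

/-- Sending `(x, y)` to `(x, x + y)` turns `rval` into a count of pairs `a < b`. -/
theorem rval_eq_card_filter_lt_sub_mem {S : Finset ℕ} (hS : 0 ∉ S) :
    rval S = ((S ×ˢ S).filter (fun p => p.1 < p.2 ∧ p.2 - p.1 ∈ S)).card := by
  refine Finset.card_bij' (fun p _ => (p.1, p.1 + p.2)) (fun p _ => (p.1, p.2 - p.1)) ?_ ?_ ?_ ?_
  · rintro ⟨x, y⟩ h
    simp only [Finset.mem_filter, Finset.mem_product] at h ⊢
    have hy : y ≠ 0 := fun hy => hS (hy ▸ h.1.2)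
    exact ⟨⟨h.1.1, h.2⟩, by omega, by simpa using h.1.2⟩
  · rintro ⟨a, b⟩ h
    simp only [Finset.mem_filter, Finset.mem_product] at h ⊢
    exact ⟨⟨h.1.1, h.2.2⟩, by simpa [Nat.add_sub_cancel' h.2.1.le] using h.1.2⟩
  · simp
  · rintro ⟨a, b⟩ h
    simp only [Finset.mem_filter] at h
    simp [Nat.add_sub_cancel' h.2.1.le]

/-- Theorem 3.1(i): the maximum of `r(S)` over all `s`-element subsets `S ⊆ [1,N]`
is `s(s-1)/2`. -/
theorem max_rval (N s : ℕ) (hN : 0 < N) (hs : 1 ≤ s) (hsN : s ≤ N) :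
    IsGreatest {v : ℕ | ∃ S : Finset ℕ, S ⊆ Finset.Icc 1 N ∧ S.card = s ∧ rval S = v}
      (s * (s - 1) / 2) := by
  constructor
  · refine ⟨Finset.Icc 1 s, Finset.Icc_subset_Icc_right hsN, by simp, ?_⟩
    have hcount := Finset.card_filter_fst_lt_snd (Finset.Icc 1 s)
    rw [Nat.card_Icc, Nat.add_sub_cancel] at hcount
    rw [rval_eq_card_filter_lt_sub_mem (by simp), ← hcount]
    congr 1
    refine Finset.filter_congr fun p hp => ?_
    simp only [Finset.mem_product, Finset.mem_Icc] at hp ⊢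
    omega
  · rintro _ ⟨S, hS, rfl, rfl⟩
    rw [rval_eq_card_filter_lt_sub_mem fun h => by simpa using hS h,
      ← Finset.card_filter_fst_lt_snd]
    exact Finset.card_le_card (Finset.monotone_filter_right _ fun _ _ h => h.1)
end

section
/- Let N be a positive integer, 1 ≤ s ≤ N, and S ⊆ [1,N] with |S| = s. Then r(S) = s(s−1)/2 if and only if S = {x_1, 2x_1, 3x_1, ..., s·x_1} for some positive integer x_1, i.e. S is an arithmetic progression whose common difference equals its smallest element. -/
/-- Twice the number of strictly increasing pairs in a finite set of size `s` is `s * (s - 1)`. -/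
theorem Finset.two_mul_card_filter_lt {α : Type*} [LinearOrder α] (S : Finset α) :
    2 * ((S ×ˢ S).filter (fun p => p.1 < p.2)).card = S.card * (S.card - 1) := by
  have hswap : ((S ×ˢ S).filter (fun p => p.2 < p.1)).card =
      ((S ×ˢ S).filter (fun p => p.1 < p.2)).card :=
    Finset.card_nbij' Prod.swap Prod.swap (by simp +contextual [Set.MapsTo])
      (by simp +contextual [Set.MapsTo]) (by simp [Set.LeftInvOn])
      (by simp [Set.LeftInvOn])
  have hunion : S.offDiag = (S ×ˢ S).filter (fun p => p.1 < p.2) ∪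
      (S ×ˢ S).filter (fun p => p.2 < p.1) := by
    ext ⟨x, y⟩
    simp only [Finset.mem_offDiag, Finset.mem_union, Finset.mem_filter, Finset.mem_product,
      ne_iff_lt_or_gt]
    tauto
  have hdisj : Disjoint ((S ×ˢ S).filter (fun p => p.1 < p.2))
      ((S ×ˢ S).filter (fun p => p.2 < p.1)) :=
    Finset.disjoint_filter.2 fun p _ h => h.not_gt
  have hcard := Finset.offDiag_card S
  rw [hunion, Finset.card_union_of_disjoint hdisj, hswap] at hcard
  rw [two_mul, hcard, Nat.mul_sub, mul_one]

/-- Replacing `(x, y)` by `(x, x + y)`, `rval S` counts pairs `x < z` in `S` with `z - x ∈ S`. -/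
theorem rval_eq_card_sub_mem {S : Finset ℕ} (hpos : ∀ x ∈ S, 0 < x) :
    rval S = (((S ×ˢ S).filter (fun p => p.1 < p.2)).filter (fun p => p.2 - p.1 ∈ S)).card := by
  refine Finset.card_nbij' (fun p => (p.1, p.1 + p.2)) (fun p => (p.1, p.2 - p.1)) ?_ ?_ ?_ ?_
  · rintro ⟨x, y⟩ h
    simp only [Finset.coe_filter, Finset.mem_product, Set.mem_ofPred_eq, Finset.mem_filter] at h ⊢
    have := hpos y h.1.2
    simp_all
  · rintro ⟨x, z⟩ h
    simp only [Finset.coe_filter, Finset.mem_product, Set.mem_ofPred_eq, Finset.mem_filter] at h ⊢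
    rw [Nat.add_sub_cancel' h.1.2.le]
    tauto
  · rintro ⟨x, y⟩ -
    simp
  · rintro ⟨x, z⟩ h
    simp only [Finset.coe_filter, Finset.mem_product, Set.mem_ofPred_eq, Finset.mem_filter] at h
    simp [Nat.add_sub_cancel' h.1.2.le]

/-- `rval S` is maximal exactly when `S` is closed under positive differences. -/
theorem rval_eq_max_iff_sub_mem {S : Finset ℕ} (hpos : ∀ x ∈ S, 0 < x) :
    rval S = S.card * (S.card - 1) / 2 ↔ ∀ x ∈ S, ∀ z ∈ S, x < z → z - x ∈ S := by
  rw [rval_eq_card_sub_mem hpos, ← Finset.two_mul_card_filter_lt,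
    Nat.mul_div_cancel_left _ two_pos, Finset.card_filter_eq_iff]
  simp only [Finset.mem_filter, Finset.mem_product, Prod.forall]
  exact ⟨fun h x hx z hz hxz => h x z ⟨⟨hx, hz⟩, hxz⟩, fun h x z hxz => h x hxz.1.1 z hxz.1.2 hxz.2⟩

/-- A nonempty finite set of positive integers closed under positive differences consists of the
first multiples of its smallest element. -/
theorem exists_eq_image_mul_of_sub_mem {S : Finset ℕ} (hne : S.Nonempty)
    (hpos : ∀ x ∈ S, 0 < x) (hsub : ∀ x ∈ S, ∀ z ∈ S, x < z → z - x ∈ S) :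
    ∃ m, 0 < m ∧ S = (Finset.range S.card).image (fun k => (k + 1) * m) := by
  obtain ⟨m, hm, hmin⟩ : ∃ m ∈ S, ∀ x ∈ S, m ≤ x :=
    ⟨S.min' hne, S.min'_mem hne, fun x hx => S.min'_le x hx⟩
  have hm0 := hpos m hm
  have hmul : ∀ z, z ∈ S → ∃ k, z = (k + 1) * m := by
    intro z
    induction z using Nat.strong_induction_on with
    | _ z ih =>
      intro hz
      rcases (hmin z hz).eq_or_lt with rfl | hlt
      · exact ⟨0, by simp⟩
      · obtain ⟨k, hk⟩ := ih (z - m) (by omega) (hsub m hm z hz hlt)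
        exact ⟨k + 1, by rw [add_mul (k + 1), ← hk]; omega⟩
  have hdown : ∀ k j, j ≤ k → (k + 1) * m ∈ S → (j + 1) * m ∈ S := by
    intro k j hjk
    induction hjk with
    | refl => exact id
    | @step k _ ih =>
      intro hk
      apply ih
      have h := hsub m hm _ hk (by nlinarith)
      rwa [add_mul (k + 1), one_mul, Nat.add_sub_cancel] at h
  obtain ⟨n, hn⟩ := hmul _ (S.max'_mem hne)
  have himage : S = (Finset.range (n + 1)).image (fun k => (k + 1) * m) := by
    ext z
    simp only [Finset.mem_image, Finset.mem_range]
    constructor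
    · intro hz
      obtain ⟨k, rfl⟩ := hmul z hz
      have h := S.le_max' _ hz
      rw [hn] at h
      exact ⟨k, by have := Nat.le_of_mul_le_mul_right h hm0; omega, rfl⟩
    · rintro ⟨k, hk, rfl⟩
      exact hdown n k (by omega) (hn ▸ S.max'_mem hne)
  have hcard : S.card = n + 1 := by
    rw [himage, Finset.card_image_of_injective, Finset.card_range]
    intro a b hab
    have := Nat.eq_of_mul_eq_mul_right hm0 hab
    omega
  exact ⟨m, hm0, hcard ▸ himage⟩

/-- The first `s` multiples of `m` are closed under positive differences. -/
theorem sub_mem_image_mul (s m : ℕ) :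
    ∀ x ∈ (Finset.range s).image (fun k => (k + 1) * m),
      ∀ z ∈ (Finset.range s).image (fun k => (k + 1) * m), x < z →
        z - x ∈ (Finset.range s).image (fun k => (k + 1) * m) := by
  simp only [Finset.mem_image, Finset.mem_range]
  rintro _ ⟨a, -, rfl⟩ _ ⟨b, hb, rfl⟩ hab
  have hlt := Nat.lt_of_mul_lt_mul_right hab
  exact ⟨b - a - 1, by omega, by rw [← Nat.sub_mul]; congr 1; omega⟩


/-- Theorem 3.1(ii): an `s`-element subset `S ⊆ [1,N]` satisfies `r(S) = s(s-1)/2`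
iff `S = {x₁, 2x₁, …, s·x₁}` for some positive integer `x₁`, i.e. `S` is an
arithmetic progression whose common difference equals its smallest element. -/
theorem rval_eq_max_iff (N s : ℕ) (hN : 0 < N) (hs : 1 ≤ s) (hsN : s ≤ N)
    (S : Finset ℕ) (hS : S ⊆ Finset.Icc 1 N) (hcard : S.card = s) :
    rval S = s * (s - 1) / 2 ↔
      ∃ x₁ : ℕ, 0 < x₁ ∧ S = (Finset.range s).image (fun k => (k + 1) * x₁) := by
  have hpos : ∀ x ∈ S, 0 < x := fun x hx => (Finset.mem_Icc.1 (hS hx)).1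
  subst hcard
  rw [rval_eq_max_iff_sub_mem hpos]
  constructor
  · exact exists_eq_image_mul_of_sub_mem (Finset.card_pos.1 hs) hpos
  · rintro ⟨m, -, h⟩
    rw [h]
    exact sub_mem_image_mul _ m
end

section
/- Let N be a positive integer and 1 ≤ s ≤ N. The minimum value f_{s,N} of r(S) over all subsets S ⊆ [1,N] with |S| = s equals 0 if s ≤ (N+1)/2, and equals (2s−N)(2s−N−1)/2 if s > (N+1)/2. -/
theorem rval_insert {m : ℕ} {S : Finset ℕ} (hm0 : 0 < m) (hS : ∀ x ∈ S, 0 < x ∧ x < m) :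
    rval (insert m S) = rval S + (S.filter (fun x => m - x ∈ S)).card := by
  have hm : m ∉ S := fun h => (hS m h).2.false
  have key : ((insert m S ×ˢ insert m S).filter (fun p => p.1 + p.2 ∈ insert m S)) =
      ((S ×ˢ S).filter (fun p => p.1 + p.2 ∈ S)) ∪
        (S.filter (fun x => m - x ∈ S)).image (fun x => (x, m - x)) := by
    ext ⟨x, y⟩
    simp only [Finset.mem_filter, Finset.mem_product, Finset.mem_insert, Finset.mem_union,
      Finset.mem_image, Prod.mk.injEq]
    constructor
    · rintro ⟨⟨hx, hy⟩, hxy⟩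
      have hx0 : x = m ∨ 0 < x ∧ x < m := hx.imp_right (hS x)
      have hy0 : y = m ∨ 0 < y ∧ y < m := hy.imp_right (hS y)
      have hxy0 : x + y = m ∨ 0 < x + y ∧ x + y < m := hxy.imp_right (hS _)
      have hxS : x ∈ S := hx.resolve_left (by omega)
      have hyS : y ∈ S := hy.resolve_left (by omega)
      rcases hxy with h | h
      · have hy' : m - x = y := by omega
        exact Or.inr ⟨x, ⟨hxS, hy' ▸ hyS⟩, rfl, hy'⟩
      · exact Or.inl ⟨⟨hxS, hyS⟩, h⟩
    · rintro (⟨⟨hx, hy⟩, hxy⟩ | ⟨z, ⟨hz, hmz⟩, rfl, rfl⟩)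
      · exact ⟨⟨Or.inr hx, Or.inr hy⟩, Or.inr hxy⟩
      · have := hS z hz
        exact ⟨⟨Or.inr hz, Or.inr hmz⟩, Or.inl (by omega)⟩
  rw [rval, key, Finset.card_union_of_disjoint, Finset.card_image_of_injective, rval]
  · intro x y h
    exact (Prod.mk.inj h).1
  · rw [Finset.disjoint_left]
    rintro ⟨x, y⟩ h h'
    simp only [Finset.mem_filter, Finset.mem_product, Finset.mem_image, Prod.mk.injEq] at h h'
    obtain ⟨z, ⟨hz, -⟩, rfl, rfl⟩ := h'
    have := hS z hz
    exact hm (by simpa [Nat.add_sub_cancel' this.2.le] using h.2)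

theorem card_filter_sub_mem_ge {N : ℕ} {S : Finset ℕ} (hS : S ⊆ Finset.Icc 1 N) :
    2 * S.card - N ≤ (S.filter (fun x => N + 1 - x ∈ S)).card := by
  have hinj : Set.InjOn (fun x => N + 1 - x) S := by
    intro x hx y hy h
    have hx' := Finset.mem_Icc.mp (hS hx)
    have hy' := Finset.mem_Icc.mp (hS hy)
    simp only at h
    omega
  have hsub : S ∩ S.image (fun x => N + 1 - x) ⊆ S.filter (fun x => N + 1 - x ∈ S) := by
    intro x hx
    obtain ⟨hxS, hx'⟩ := Finset.mem_inter.mp hx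
    obtain ⟨y, hy, rfl⟩ := Finset.mem_image.mp hx'
    have hy' := Finset.mem_Icc.mp (hS hy)
    refine Finset.mem_filter.mpr ⟨hxS, ?_⟩
    rwa [Nat.sub_sub_self (by omega)]
  have hunion : S ∪ S.image (fun x => N + 1 - x) ⊆ Finset.Icc 1 N := by
    refine Finset.union_subset hS (Finset.image_subset_iff.mpr fun x hx => ?_)
    have hx' := Finset.mem_Icc.mp (hS hx)
    exact Finset.mem_Icc.mpr (by omega)
  have h₁ := Finset.card_le_card hsub
  have h₂ := Finset.card_le_card hunion
  have h₃ := Finset.card_union_add_card_inter S (S.image (fun x => N + 1 - x))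
  rw [Finset.card_image_of_injOn hinj] at h₃
  rw [Nat.card_Icc] at h₂
  omega

theorem choose_succ_two (n : ℕ) : (n + 1).choose 2 = n.choose 2 + n := by
  rw [Nat.choose_succ_succ' n 1, Nat.choose_one_right, add_comm]

theorem choose_two_le_rval {N : ℕ} {S : Finset ℕ} (hS : S ⊆ Finset.Icc 1 N) :
    (2 * S.card - N).choose 2 ≤ rval S := by
  induction N generalizing S with
  | zero =>
    have : S = ∅ := by simpa using hS
    simp [this]
  | succ N ih =>
    have herase : S.erase (N + 1) ⊆ Finset.Icc 1 N := by
      intro x hx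
      obtain ⟨hne, hxS⟩ := Finset.mem_erase.mp hx
      have := Finset.mem_Icc.mp (hS hxS)
      exact Finset.mem_Icc.mpr (by omega)
    by_cases hmem : N + 1 ∈ S
    · have hcard := Finset.card_erase_add_one hmem
      have hr := rval_insert (m := N + 1) (S := S.erase (N + 1)) N.succ_pos fun x hx => by
        have := Finset.mem_Icc.mp (herase hx)
        omega
      rw [Finset.insert_erase hmem] at hr
      have h₁ := ih herase
      have h₂ := card_filter_sub_mem_ge herase
      have h₃ := choose_succ_two (2 * (S.erase (N + 1)).card - N)
      have h₄ : (2 * S.card - (N + 1)).choose 2 ≤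
          (2 * (S.erase (N + 1)).card - N + 1).choose 2 :=
        Nat.choose_le_choose 2 (by omega)
      omega
    · rw [Finset.erase_eq_of_notMem hmem] at herase
      exact (Nat.choose_le_choose 2 (by omega)).trans (ih herase)

theorem rval_Icc {a : ℕ} (ha : 0 < a) (N : ℕ) :
    rval (Finset.Icc a N) = (N + 2 - 2 * a).choose 2 := by
  induction N with
  | zero =>
    rw [Finset.Icc_eq_empty (by omega), Nat.choose_eq_zero_of_lt (by omega)]
    rfl
  | succ N ih =>
    by_cases haN : a ≤ N + 1
    · have hfilter : (Finset.Icc a N).filter (fun x => N + 1 - x ∈ Finset.Icc a N) =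
          Finset.Icc a (N + 1 - a) := by
        ext x
        simp only [Finset.mem_filter, Finset.mem_Icc]
        omega
      have hinsert : insert (N + 1) (Finset.Icc a N) = Finset.Icc a (N + 1) :=
        Finset.insert_Icc_right_eq_Icc_succ haN
      rw [← hinsert, rval_insert N.succ_pos, ih, hfilter, Nat.card_Icc]
      · by_cases h : 2 * a ≤ N + 2
        · rw [show N + 1 + 2 - 2 * a = N + 2 - 2 * a + 1 by omega, choose_succ_two]
          omega
        · rw [show N + 1 + 2 - 2 * a = 0 by omega, show N + 2 - 2 * a = 0 by omega]
          omega
      · intro x hx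
        have := Finset.mem_Icc.mp hx
        omega
    · rw [Finset.Icc_eq_empty (by omega), Nat.choose_eq_zero_of_lt (by omega)]
      rfl

/-- Theorem 3.3: the minimum of `r(S)` over `s`-element subsets `S ⊆ [1,N]` is `0`
if `s ≤ (N+1)/2`, and `(2s−N)(2s−N−1)/2` if `s > (N+1)/2`. -/
theorem min_rval (N s : ℕ) (hN : 0 < N) (hs : 1 ≤ s) (hsN : s ≤ N) :
    IsLeast {v : ℕ | ∃ S : Finset ℕ, S ⊆ Finset.Icc 1 N ∧ S.card = s ∧ rval S = v}
      (if 2 * s ≤ N + 1 then 0 else (2 * s - N) * (2 * s - N - 1) / 2) := by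
  have hval : (if 2 * s ≤ N + 1 then 0 else (2 * s - N) * (2 * s - N - 1) / 2) =
      (2 * s - N).choose 2 := by
    split_ifs with h
    · exact (Nat.choose_eq_zero_of_lt (by omega)).symm
    · exact (Nat.choose_two_right _).symm
  rw [hval]
  constructor
  · refine ⟨Finset.Icc (N - s + 1) N, Finset.Icc_subset_Icc_left (by omega), ?_, ?_⟩
    · rw [Nat.card_Icc]
      omega
    · rw [rval_Icc (Nat.succ_pos _)]
      congr 1
      omega
  · rintro _ ⟨S, hS, rfl, rfl⟩
    exact choose_two_le_rval hS
end

section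
/- Let S ⊆ [1,N] with |S| = s > 3, r(S) = 0, and |(S − S)⁺| = s. If s > 4, then S has one of the following forms for some positive integers x, a: (i) S = {x, x+a, ..., x+sa} \ {x+ia} for some 1 ≤ i ≤ s−1, or (ii) S = {x, x+a, ..., x+(s+1)a} \ {x+a, x+sa}. If s = 4, then S is of type (i), of type (ii), or of the form S = {x, x+a, x+a+b, x+2a+b} for some positive integers x, a, b. -/
/-- `(S − S)⁺`: the set of positive differences of elements of `S`. -/
def posDiffs (S : Finset ℕ) : Finset ℕ :=
  ((S ×ˢ S).filter (fun p => p.2 < p.1)).image (fun p => p.1 - p.2)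

theorem mem_posDiffs {S : Finset ℕ} {d : ℕ} :
    d ∈ posDiffs S ↔ ∃ y ∈ S, ∃ z ∈ S, y < z ∧ z - y = d := by
  simp only [posDiffs, Finset.mem_image, Finset.mem_filter, Finset.mem_product, Prod.exists]
  constructor
  · rintro ⟨z, y, ⟨⟨hz, hy⟩, hlt⟩, rfl⟩
    exact ⟨y, hy, z, hz, hlt, rfl⟩
  · rintro ⟨y, hy, z, hz, hlt, rfl⟩
    exact ⟨z, y, ⟨⟨hz, hy⟩, hlt⟩, rfl⟩

theorem posDiffs_mono {S T : Finset ℕ} (h : S ⊆ T) : posDiffs S ⊆ posDiffs T := by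
  intro d hd
  obtain ⟨y, hy, z, hz, hlt, rfl⟩ := mem_posDiffs.1 hd
  exact mem_posDiffs.2 ⟨y, h hy, z, h hz, hlt, rfl⟩

theorem sub_mem_posDiffs_insert {S : Finset ℕ} {M y : ℕ} (hM : ∀ y ∈ S, y < M) (hy : y ∈ S) :
    M - y ∈ posDiffs (insert M S) :=
  mem_posDiffs.2 ⟨y, Finset.mem_insert_of_mem hy, M, Finset.mem_insert_self M S, hM y hy, rfl⟩

theorem exists_eq_insert_max {S : Finset ℕ} {n : ℕ} (h : S.card = n + 1) :
    ∃ (M : ℕ) (T : Finset ℕ), S = insert M T ∧ (∀ y ∈ T, y < M) ∧ T.card = n := by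
  have hne : S.Nonempty := Finset.card_pos.1 (by omega)
  refine ⟨S.max' hne, S.erase (S.max' hne), (Finset.insert_erase (S.max'_mem hne)).symm, ?_, ?_⟩
  · intro y hy
    exact S.lt_max'_of_mem_erase_max' hne hy
  · rw [Finset.card_erase_of_mem (S.max'_mem hne), h, Nat.add_sub_cancel]

theorem sub_min_notMem_posDiffs {S : Finset ℕ} {M m : ℕ} (hM : ∀ y ∈ S, y < M)
    (hm : ∀ y ∈ S, m ≤ y) : M - m ∉ posDiffs S := by
  intro h
  obtain ⟨y, hy, z, hz, hlt, he⟩ := mem_posDiffs.1 h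
  have := hM z hz
  have := hm y hy
  omega

/-- Differences with the new maximum `M` that are not differences of `S` are bounded in number. -/
theorem card_add_card_posDiffs_le {S T : Finset ℕ} {M : ℕ} (hM : ∀ y ∈ S, y < M) (hT : T ⊆ S)
    (hnew : ∀ y ∈ T, M - y ∉ posDiffs S) :
    T.card + (posDiffs S).card ≤ (posDiffs (insert M S)).card := by
  have hinj : (T.image (M - ·)).card = T.card := by
    refine Finset.card_image_of_injOn ?_
    intro y hy z hz hyz
    have := hM y (hT hy)
    have := hM z (hT hz)
    simp only at hyz
    omega
  rw [← hinj, ← Finset.card_union_of_disjoint]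
  · refine Finset.card_le_card (Finset.union_subset ?_ (posDiffs_mono (Finset.subset_insert M S)))
    intro d hd
    obtain ⟨y, hy, rfl⟩ := Finset.mem_image.1 hd
    exact sub_mem_posDiffs_insert hM (hT hy)
  · rw [Finset.disjoint_left]
    intro d hd
    obtain ⟨y, hy, rfl⟩ := Finset.mem_image.1 hd
    exact hnew y hy

theorem card_posDiffs_lt_insert {S : Finset ℕ} {M : ℕ} (hne : S.Nonempty)
    (hM : ∀ y ∈ S, y < M) : (posDiffs S).card < (posDiffs (insert M S)).card := by
  have := card_add_card_posDiffs_le (T := {S.min' hne}) hM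
    (by simpa using S.min'_mem hne) (by
      intro y hy
      rw [Finset.mem_singleton.1 hy]
      exact sub_min_notMem_posDiffs hM fun y hy => S.min'_le y hy)
  rw [Finset.card_singleton] at this
  omega

theorem card_le_card_posDiffs_add_one (n : ℕ) :
    ∀ S : Finset ℕ, S.card = n + 1 → n ≤ (posDiffs S).card := by
  induction n with
  | zero => simp
  | succ n ih =>
    intro S hS
    obtain ⟨M, T, rfl, hM, hT⟩ := exists_eq_insert_max hS
    have := ih T hT
    have := card_posDiffs_lt_insert (Finset.card_pos.1 (by omega)) hM
    omega

theorem sub_mem_posDiffs_of_card_le {S : Finset ℕ} {M m y : ℕ} (hM : ∀ y ∈ S, y < M)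
    (hmS : m ∈ S) (hm : ∀ y ∈ S, m ≤ y) (hc : (posDiffs (insert M S)).card ≤ (posDiffs S).card + 1)
    (hy : y ∈ S) (hym : m < y) : M - y ∈ posDiffs S := by
  by_contra hnot
  have := card_add_card_posDiffs_le (T := {m, y}) hM
    (by simp [Finset.insert_subset_iff, hmS, hy]) (by
      intro z hz
      rcases Finset.mem_insert.1 hz with rfl | hz
      · exact sub_min_notMem_posDiffs hM hm
      · rwa [Finset.mem_singleton.1 hz])
  rw [Finset.card_pair hym.ne] at this
  omega

/-- The elements of `S` are the `x + k * a` with `k` satisfying `p`. -/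
def IsAPPart (S : Finset ℕ) (x a : ℕ) (p : ℕ → Prop) : Prop :=
  ∀ z, z ∈ S ↔ ∃ k, p k ∧ z = x + k * a

namespace IsAPPart

variable {S : Finset ℕ} {x a : ℕ} {p : ℕ → Prop}

theorem mem (h : IsAPPart S x a p) {k : ℕ} (hk : p k) : x + k * a ∈ S :=
  (h _).2 ⟨k, hk, rfl⟩

theorem le_of_mem (h : IsAPPart S x a p) {y : ℕ} (hy : y ∈ S) : x ≤ y := by
  obtain ⟨k, -, rfl⟩ := (h _).1 hy
  omega

theorem exists_of_mem_posDiffs (h : IsAPPart S x a p) {d : ℕ}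
    (hd : d ∈ posDiffs S) : ∃ j k, p j ∧ p k ∧ j < k ∧ d = (k - j) * a := by
  obtain ⟨y, hy, z, hz, hlt, rfl⟩ := mem_posDiffs.1 hd
  obtain ⟨j, hj, rfl⟩ := (h _).1 hy
  obtain ⟨k, hk, rfl⟩ := (h _).1 hz
  have hjk : j < k := lt_of_mul_lt_mul_right (Nat.lt_of_add_lt_add_left hlt) (Nat.zero_le a)
  refine ⟨j, k, hj, hk, hjk, ?_⟩
  rw [Nat.sub_mul]
  omega

theorem insert_term (h : IsAPPart S x a p) (n : ℕ) {q : ℕ → Prop} (hq : ∀ k, q k ↔ k = n ∨ p k) :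
    IsAPPart (insert (x + n * a) S) x a q := by
  intro z
  rw [Finset.mem_insert, h z]
  constructor
  · rintro (rfl | ⟨k, hk, rfl⟩)
    · exact ⟨n, (hq n).2 (Or.inl rfl), rfl⟩
    · exact ⟨k, (hq k).2 (Or.inr hk), rfl⟩
  · rintro ⟨k, hk, rfl⟩
    rcases (hq k).1 hk with rfl | hk
    · exact Or.inl rfl
    · exact Or.inr ⟨k, hk, rfl⟩

/-- If `M` exceeds `x + l * a` and its distance to `x + j * a` is a difference of `S`, then `M`
lies in the progression. -/
theorem exists_eq_of_sub_mem (h : IsAPPart S x a p) {M j : ℕ} (hj : x + j * a < M)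
    (hd : M - (x + j * a) ∈ posDiffs S) :
    ∃ u v, p u ∧ p v ∧ u < v ∧ M = x + (j + (v - u)) * a := by
  obtain ⟨u, v, hu, hv, huv, he⟩ := h.exists_of_mem_posDiffs hd
  refine ⟨u, v, hu, hv, huv, ?_⟩
  rw [Nat.add_mul]
  omega

theorem card_posDiffs_le {n : ℕ} (h : IsAPPart S x a (· ≤ n)) : (posDiffs S).card ≤ n := by
  calc (posDiffs S).card ≤ ((Finset.Icc 1 n).image (· * a)).card := by
        refine Finset.card_le_card fun d hd => ?_
        obtain ⟨j, k, hj, hk, hjk, rfl⟩ := h.exists_of_mem_posDiffs hd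
        refine Finset.mem_image.2 ⟨k - j, Finset.mem_Icc.2 ⟨?_, ?_⟩, rfl⟩ <;> omega
    _ ≤ (Finset.Icc 1 n).card := Finset.card_image_le
    _ = n := by simp

theorem lt_of_lt (h : IsAPPart S x a p) {M k n : ℕ} (hM : ∀ y ∈ S, y < M) (hk : p k)
    (he : M = x + n * a) : k < n := by
  have := hM _ (h.mem hk)
  rw [he] at this
  exact lt_of_mul_lt_mul_right (Nat.lt_of_add_lt_add_left this) (Nat.zero_le a)

end IsAPPart

theorem exists_isAPPart_of_card_posDiffs_le (n : ℕ) :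
    ∀ S : Finset ℕ, S.card = n + 2 → (posDiffs S).card ≤ n + 1 →
      ∃ x a, 0 < a ∧ IsAPPart S x a (· ≤ n + 1) := by
  induction n with
  | zero =>
    intro S hS _
    obtain ⟨M, T, rfl, hM, hT⟩ := exists_eq_insert_max hS
    obtain ⟨m, rfl⟩ := Finset.card_eq_one.1 hT
    have hmM := hM m (Finset.mem_singleton_self m)
    refine ⟨m, M - m, by omega, fun z => ?_⟩
    simp only [Finset.mem_insert, Finset.mem_singleton]
    constructor
    · rintro (rfl | rfl)
      · exact ⟨1, by omega, by omega⟩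
      · exact ⟨0, by omega, by omega⟩
    · rintro ⟨k, hk, rfl⟩
      have : k = 0 ∨ k = 1 := by omega
      rcases this with rfl | rfl <;> omega
  | succ n ih =>
    intro S hS hD
    obtain ⟨M, T, rfl, hM, hT⟩ := exists_eq_insert_max hS
    have hlt := card_posDiffs_lt_insert (Finset.card_pos.1 (by omega)) hM
    have hge := card_le_card_posDiffs_add_one (n + 1) T hT
    obtain ⟨x, a, ha, h⟩ := ih T hT (by omega)
    have h0 : x ∈ T := by simpa using h.mem (k := 0) (by omega)
    have h1 := h.mem (k := 1) (by omega)
    have hd := sub_mem_posDiffs_of_card_le hM h0 (fun y hy => h.le_of_mem hy) (by omega) h1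
      (by omega)
    obtain ⟨u, v, hu, hv, huv, he⟩ := h.exists_eq_of_sub_mem (hM _ h1) hd
    have hl := h.lt_of_lt hM (le_refl (n + 1)) he
    refine ⟨x, a, ha, ?_⟩
    rw [he]
    exact h.insert_term _ fun k => by omega

/-- Adding a new maximum to a progression so that two new differences appear. -/
theorem IsAPPart.insert_of_card_posDiffs {S : Finset ℕ} {x a n M : ℕ} (ha : 0 < a)
    (h : IsAPPart S x a (· ≤ n + 2)) (hM : ∀ y ∈ S, y < M) (hS : n + 2 ≤ (posDiffs S).card)
    (hD : (posDiffs (insert M S)).card = n + 4) :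
    IsAPPart (insert M S) x a (fun k => k ≤ n + 4 ∧ k ≠ n + 3) := by
  have hmem : ∀ {k}, k ≤ n + 2 → x + k * a ∈ S := fun hk => h.mem hk
  have hne : M ≠ x + (n + 3) * a := by
    rintro rfl
    have := (h.insert_term (n + 3) (q := (· ≤ n + 3)) fun k => by omega).card_posDiffs_le
    omega
  have key : ∀ j, x + j * a < M → M - (x + j * a) ∈ posDiffs S →
      ∃ l, n + 3 < l ∧ l ≤ j + (n + 2) ∧ M = x + l * a := by
    intro j hj hd
    obtain ⟨u, v, hu, hv, huv, he⟩ := h.exists_eq_of_sub_mem hj hd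
    have hl := h.lt_of_lt hM (le_refl (n + 2)) he
    refine ⟨_, ?_, ?_, he⟩
    · by_contra hcon
      have : j + (v - u) = n + 3 := by omega
      exact hne (this ▸ he)
    · omega
  have h0 : x + 0 * a ∈ S := hmem (by omega)
  have h1 : x + 1 * a ∈ S := hmem (by omega)
  have h2 : x + 2 * a ∈ S := hmem (by omega)
  have hn1 : M - (x + 1 * a) ∉ posDiffs S := by
    intro hd
    obtain ⟨l, h3, h4, -⟩ := key 1 (hM _ h1) hd
    omega
  have hd2 : M - (x + 2 * a) ∈ posDiffs S := by
    by_contra hn2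
    have := card_add_card_posDiffs_le (T := {x + 0 * a, x + 1 * a, x + 2 * a}) hM
      (by simp only [Finset.insert_subset_iff, Finset.singleton_subset_iff, h0, h1, h2, and_self])
      (by
        intro z hz
        simp only [Finset.mem_insert, Finset.mem_singleton] at hz
        rcases hz with rfl | rfl | rfl
        · exact sub_min_notMem_posDiffs hM fun y hy => by simpa using h.le_of_mem hy
        · exact hn1
        · exact hn2)
    rw [Finset.card_eq_three.2 ⟨_, _, _, by omega, by omega, by omega, rfl⟩] at this
    omega
  obtain ⟨l, h3, h4, rfl⟩ := key 2 (hM _ h2) hd2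
  obtain rfl : l = n + 4 := by omega
  exact h.insert_term _ fun k => by omega

/-- The four-element sets with gaps `a, b, a`. -/
def IsSymmQuad (S : Finset ℕ) : Prop :=
  ∃ x a b : ℕ, 0 < a ∧ 0 < b ∧ S = {x, x + a, x + a + b, x + 2 * a + b}

/-- A progression of `n + 1` terms with an interior term removed. -/
def IsPuncturedAP (S : Finset ℕ) (n : ℕ) : Prop :=
  ∃ x a i : ℕ, 0 < a ∧ 1 ≤ i ∧ i < n ∧ IsAPPart S x a (fun k => k ≤ n ∧ k ≠ i)

/-- A progression of `n + 2` terms with its second and its second-to-last term removed. -/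
def IsTwicePuncturedAP (S : Finset ℕ) (n : ℕ) : Prop :=
  ∃ x a : ℕ, 0 < a ∧ IsAPPart S x a (fun k => k ≤ n + 1 ∧ k ≠ 1 ∧ k ≠ n)

theorem mem_posDiffs_triple {w p q d : ℕ} :
    d ∈ posDiffs {w, w + p, w + p + q} → d = p ∨ d = q ∨ d = p + q := by
  intro h
  obtain ⟨y, hy, z, hz, hlt, rfl⟩ := mem_posDiffs.1 h
  simp only [Finset.mem_insert, Finset.mem_singleton] at hy hz
  omega

theorem mem_posDiffs_symmQuad {x a b d : ℕ} :
    d ∈ posDiffs {x, x + a, x + a + b, x + 2 * a + b} →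
      d = a ∨ d = b ∨ d = a + b ∨ d = 2 * a + b := by
  intro h
  obtain ⟨y, hy, z, hz, hlt, rfl⟩ := mem_posDiffs.1 h
  simp only [Finset.mem_insert, Finset.mem_singleton] at hy hz
  omega

theorem structure_of_card_posDiffs_eq_four {S : Finset ℕ} (hS : S.card = 4)
    (hD : (posDiffs S).card = 4) : IsPuncturedAP S 4 ∨ IsSymmQuad S := by
  obtain ⟨M, T, rfl, hM, hT⟩ := exists_eq_insert_max hS
  have hlt := card_posDiffs_lt_insert (Finset.card_pos.1 (by omega)) hM
  have hge := card_le_card_posDiffs_add_one 2 T hT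
  by_cases hT2 : (posDiffs T).card ≤ 2
  · obtain ⟨x, a, ha, h⟩ := exists_isAPPart_of_card_posDiffs_le 1 T hT hT2
    exact Or.inl ⟨x, a, 3, ha, by omega, by omega,
      h.insert_of_card_posDiffs (n := 0) ha hM hge hD⟩
  obtain ⟨c, T₂, rfl, hc, hT₂⟩ := exists_eq_insert_max hT
  obtain ⟨b, T₁, rfl, hb, hT₁⟩ := exists_eq_insert_max hT₂
  obtain ⟨w, rfl⟩ := Finset.card_eq_one.1 hT₁
  obtain ⟨p, rfl⟩ := Nat.exists_eq_add_of_lt (hb w (by simp))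
  obtain ⟨q, rfl⟩ := Nat.exists_eq_add_of_lt (hc (w + p + 1) (by simp))
  obtain ⟨r, rfl⟩ := Nat.exists_eq_add_of_lt (hM (w + p + 1 + q + 1) (by simp))
  have hset : ({w + p + 1 + q + 1, w + p + 1, w} : Finset ℕ) =
      {w, w + (p + 1), w + (p + 1) + (q + 1)} := by
    ext z
    simp only [Finset.mem_insert, Finset.mem_singleton]
    omega
  rw [hset] at hM hT2 hD hlt ⊢
  have hm : ∀ y ∈ ({w, w + (p + 1), w + (p + 1) + (q + 1)} : Finset ℕ), w ≤ y := by
    simp only [Finset.mem_insert, Finset.mem_singleton]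
    omega
  have h1 := mem_posDiffs_triple (sub_mem_posDiffs_of_card_le (y := w + (p + 1)) hM (by simp) hm
    (by omega) (by simp) (by omega))
  have h2 := mem_posDiffs_triple (sub_mem_posDiffs_of_card_le (y := w + (p + 1) + (q + 1)) hM
    (by simp) hm (by omega) (by simp) (by omega))
  have hpq : p ≠ q := by
    rintro rfl
    refine hT2 ((Finset.card_le_card (t := {p + 1, 2 * (p + 1)}) fun d hd => ?_).trans
      Finset.card_le_two)
    have := mem_posDiffs_triple hd
    simp only [Finset.mem_insert, Finset.mem_singleton]
    omega
  have hr : r = p ∨ (r = q ∧ p + 1 = 2 * (q + 1)) := by omega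
  rcases hr with rfl | ⟨rfl, hp⟩
  · refine Or.inr ⟨w, r + 1, q + 1, by omega, by omega, ?_⟩
    ext z
    simp only [Finset.mem_insert, Finset.mem_singleton]
    omega
  · refine Or.inl ⟨w, r + 1, 1, by omega, by omega, by omega, fun z => ?_⟩
    simp only [Finset.mem_insert, Finset.mem_singleton]
    constructor
    · rintro (h | h | h | h)
      · exact ⟨4, by omega, by omega⟩
      · exact ⟨0, by omega, by omega⟩
      · exact ⟨2, by omega, by omega⟩
      · exact ⟨3, by omega, by omega⟩
    · rintro ⟨k, ⟨hk, hk1⟩, rfl⟩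
      interval_cases k <;> omega

theorem IsPuncturedAP.insert_of_card_posDiffs {S : Finset ℕ} {n M : ℕ} (hn : 4 ≤ n)
    (h : IsPuncturedAP S n) (hM : ∀ y ∈ S, y < M)
    (hD : (posDiffs (insert M S)).card ≤ (posDiffs S).card + 1) :
    IsPuncturedAP (insert M S) (n + 1) ∨ IsTwicePuncturedAP (insert M S) (n + 1) := by
  obtain ⟨x, a, i, ha, hi, hin, h⟩ := h
  have h0 : x ∈ S := by simpa using h.mem (k := 0) (by omega)
  have key : ∀ j, 0 < j → j ≤ n → j ≠ i → ∃ l, n < l ∧ l ≤ j + n ∧ M = x + l * a := by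
    intro j hj hjn hji
    have hjS := h.mem ⟨hjn, hji⟩
    have hpos : 0 < j * a := Nat.mul_pos hj ha
    obtain ⟨u, v, hu, hv, huv, he⟩ := h.exists_eq_of_sub_mem (hM _ hjS)
      (sub_mem_posDiffs_of_card_le hM h0 (fun y hy => h.le_of_mem hy) hD hjS (by omega))
    exact ⟨_, h.lt_of_lt hM (k := n) (by omega) he, by omega, he⟩
  by_cases hi1 : i = 1
  · subst hi1
    obtain ⟨l, hl, hl', rfl⟩ := key 2 (by omega) (by omega) (by omega)
    have : l = n + 1 ∨ l = n + 2 := by omega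
    rcases this with rfl | rfl
    · exact Or.inl ⟨x, a, 1, ha, by omega, by omega, h.insert_term _ fun k => by omega⟩
    · exact Or.inr ⟨x, a, ha, h.insert_term _ fun k => by omega⟩
  · obtain ⟨l, hl, hl', rfl⟩ := key 1 (by omega) (by omega) (by omega)
    obtain rfl : l = n + 1 := by omega
    exact Or.inl ⟨x, a, i, ha, by omega, by omega, h.insert_term _ fun k => by omega⟩

theorem IsTwicePuncturedAP.card_posDiffs_insert {S : Finset ℕ} {n M : ℕ} (hn : 4 ≤ n)
    (h : IsTwicePuncturedAP S n) (hM : ∀ y ∈ S, y < M) :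
    (posDiffs S).card + 1 < (posDiffs (insert M S)).card := by
  by_contra! hD
  obtain ⟨x, a, ha, h⟩ := h
  have h0 : x ∈ S := by simpa using h.mem (k := 0) (by omega)
  have key : ∀ j, 1 < j → j < n → ∃ l, n + 1 < l ∧ l ≤ j + (n + 1) ∧ l ≠ j + n ∧
      M = x + l * a := by
    intro j hj hjn
    have hjS := h.mem (k := j) (by omega)
    have hpos : 0 < j * a := Nat.mul_pos (by omega) ha
    obtain ⟨u, v, hu, hv, huv, he⟩ := h.exists_eq_of_sub_mem (hM _ hjS)
      (sub_mem_posDiffs_of_card_le hM h0 (fun y hy => h.le_of_mem hy) hD hjS (by omega))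
    exact ⟨_, h.lt_of_lt hM (k := n + 1) (by omega) he, by omega, by omega, he⟩
  obtain ⟨l, hl, hl', hl2, he⟩ := key 2 (by omega) (by omega)
  obtain ⟨m, hm, hm', hm2, he'⟩ := key 3 (by omega) (by omega)
  have : l = m := Nat.eq_of_mul_eq_mul_right ha (by omega)
  omega

theorem IsSymmQuad.insert_of_card_posDiffs {S : Finset ℕ} {M : ℕ} (h : IsSymmQuad S)
    (hS : (posDiffs S).card = 4) (hM : ∀ y ∈ S, y < M)
    (hD : (posDiffs (insert M S)).card ≤ 5) : IsPuncturedAP (insert M S) 5 := by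
  obtain ⟨x, a, b, ha, hb, rfl⟩ := h
  have hm : ∀ y ∈ ({x, x + a, x + a + b, x + 2 * a + b} : Finset ℕ), x ≤ y := by
    simp only [Finset.mem_insert, Finset.mem_singleton]
    omega
  have h1 := mem_posDiffs_symmQuad (sub_mem_posDiffs_of_card_le (y := x + a) hM (by simp) hm
    (by omega) (by simp) (by omega))
  have h2 := mem_posDiffs_symmQuad (sub_mem_posDiffs_of_card_le (y := x + a + b) hM (by simp) hm
    (by omega) (by simp) (by omega))
  have hlt := hM (x + 2 * a + b) (by simp)
  have hab : a ≠ b := by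
    rintro rfl
    have : (posDiffs {x, x + a, x + a + a, x + 2 * a + a}).card ≤ 3 :=
      (Finset.card_le_card (t := {a, 2 * a, 3 * a}) fun d hd => by
        have := mem_posDiffs_symmQuad hd
        simp only [Finset.mem_insert, Finset.mem_singleton]
        omega).trans Finset.card_le_three
    omega
  obtain ⟨rfl, rfl⟩ : b = 2 * a ∧ M = x + 5 * a := by omega
  refine ⟨x, a, 2, ha, by omega, by omega, fun z => ?_⟩
  simp only [Finset.mem_insert, Finset.mem_singleton]
  constructor
  · rintro (h | h | h | h | h)
    · exact ⟨5, by omega, by omega⟩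
    · exact ⟨0, by omega, by omega⟩
    · exact ⟨1, by omega, by omega⟩
    · exact ⟨3, by omega, by omega⟩
    · exact ⟨4, by omega, by omega⟩
  · rintro ⟨k, ⟨hk, hk1⟩, rfl⟩
    interval_cases k <;> omega

theorem structure_of_card_posDiffs_eq_card (n : ℕ) (hn : 4 ≤ n) :
    ∀ S : Finset ℕ, S.card = n → (posDiffs S).card = n →
      IsPuncturedAP S n ∨ IsTwicePuncturedAP S n ∨ (n = 4 ∧ IsSymmQuad S) := by
  induction n, hn using Nat.le_induction with
  | base =>
    intro S hS hD
    rcases structure_of_card_posDiffs_eq_four hS hD with h | h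
    · exact Or.inl h
    · exact Or.inr (Or.inr ⟨rfl, h⟩)
  | succ n hn ih =>
    intro S hS hD
    obtain ⟨M, T, rfl, hM, hT⟩ := exists_eq_insert_max hS
    have hlt := card_posDiffs_lt_insert (Finset.card_pos.1 (by omega)) hM
    have hge := card_le_card_posDiffs_add_one (n - 1) T (by omega)
    by_cases hTn : (posDiffs T).card = n
    · rcases ih T hT hTn with h | h | ⟨rfl, h⟩
      · rcases h.insert_of_card_posDiffs hn hM (by omega) with h | h
        · exact Or.inl h
        · exact Or.inr (Or.inl h)
      · have := h.card_posDiffs_insert hn hM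
        omega
      · exact Or.inl (h.insert_of_card_posDiffs hTn hM (by omega))
    · obtain ⟨m, rfl⟩ := Nat.exists_eq_add_of_le' hn
      obtain ⟨x, a, ha, h⟩ := exists_isAPPart_of_card_posDiffs_le (m + 2) T hT (by omega)
      exact Or.inl ⟨x, a, m + 4, ha, by omega, by omega,
        h.insert_of_card_posDiffs (n := m + 1) ha hM (by omega) hD⟩

theorem IsPuncturedAP.exists_eq {S : Finset ℕ} {n : ℕ} (h : IsPuncturedAP S n) (hS : 0 ∉ S) :
    ∃ x a i : ℕ, 0 < x ∧ 0 < a ∧ 1 ≤ i ∧ i ≤ n - 1 ∧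
      S = (((Finset.range (n + 1)).image (fun k => x + k * a)).erase (x + i * a)) := by
  obtain ⟨x, a, i, ha, hi, hin, h⟩ := h
  have h0 : x ∈ S := by simpa using h.mem (k := 0) (by omega)
  refine ⟨x, a, i, Nat.pos_of_ne_zero (ne_of_mem_of_not_mem h0 hS), ha, hi, by omega, ?_⟩
  ext z
  rw [h z, Finset.mem_erase, Finset.mem_image]
  constructor
  · rintro ⟨k, ⟨hk, hki⟩, rfl⟩
    exact ⟨fun he => hki (Nat.eq_of_mul_eq_mul_right ha (by omega)), k, by simp; omega, rfl⟩
  · rintro ⟨hne, k, hk, rfl⟩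
    rw [Finset.mem_range] at hk
    exact ⟨k, ⟨by omega, fun he => hne (by rw [he])⟩, rfl⟩

theorem IsTwicePuncturedAP.exists_eq {S : Finset ℕ} {n : ℕ} (hn : 0 < n)
    (h : IsTwicePuncturedAP S n) (hS : 0 ∉ S) :
    ∃ x a : ℕ, 0 < x ∧ 0 < a ∧
      S = ((Finset.range (n + 2)).image (fun k => x + k * a)) \ {x + a, x + n * a} := by
  obtain ⟨x, a, ha, h⟩ := h
  have h0 : x ∈ S := by simpa using h.mem (k := 0) (by omega)
  refine ⟨x, a, Nat.pos_of_ne_zero (ne_of_mem_of_not_mem h0 hS), ha, ?_⟩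
  ext z
  rw [h z, Finset.mem_sdiff, Finset.mem_image, Finset.mem_insert, Finset.mem_singleton]
  constructor
  · rintro ⟨k, ⟨hk, hk1, hkn⟩, rfl⟩
    refine ⟨⟨k, by simp; omega, rfl⟩, ?_⟩
    rintro (he | he)
    · exact hk1 (Nat.eq_of_mul_eq_mul_right ha (by omega))
    · exact hkn (Nat.eq_of_mul_eq_mul_right ha (by omega))
  · rintro ⟨⟨k, hk, rfl⟩, hne⟩
    rw [Finset.mem_range] at hk
    refine ⟨k, ⟨by omega, ?_, ?_⟩, rfl⟩
    · rintro rfl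
      exact hne (Or.inl (by rw [one_mul]))
    · rintro rfl
      exact hne (Or.inr rfl)

/-- Proposition 4.3: structure of sum-free `s`-sets (`s > 3`) whose set of positive
differences has exactly `s` elements. -/
theorem structure_of_sumfree_posDiffs_card_eq (N s : ℕ) (hN : 0 < N) (S : Finset ℕ)
    (hS : S ⊆ Finset.Icc 1 N) (hcard : S.card = s) (hs : 3 < s)
    (hr : rval S = 0) (hdiff : (posDiffs S).card = s) :
    (4 < s →
      ((∃ x a i : ℕ, 0 < x ∧ 0 < a ∧ 1 ≤ i ∧ i ≤ s - 1 ∧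
          S = (((Finset.range (s + 1)).image (fun k => x + k * a)).erase (x + i * a))) ∨
        (∃ x a : ℕ, 0 < x ∧ 0 < a ∧
          S = ((Finset.range (s + 2)).image (fun k => x + k * a)) \ {x + a, x + s * a}))) ∧
    (s = 4 →
      ((∃ x a i : ℕ, 0 < x ∧ 0 < a ∧ 1 ≤ i ∧ i ≤ s - 1 ∧
          S = (((Finset.range (s + 1)).image (fun k => x + k * a)).erase (x + i * a))) ∨
        (∃ x a : ℕ, 0 < x ∧ 0 < a ∧
          S = ((Finset.range (s + 2)).image (fun k => x + k * a)) \ {x + a, x + s * a}) ∨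
        (∃ x a b : ℕ, 0 < x ∧ 0 < a ∧ 0 < b ∧
          S = {x, x + a, x + a + b, x + 2 * a + b}))) := by
  have h0 : 0 ∉ S := fun h => by simpa using hS h
  have key := structure_of_card_posDiffs_eq_card s hs S hcard hdiff
  constructor
  · intro hs5
    rcases key with h | h | ⟨h4, -⟩
    · exact Or.inl (h.exists_eq h0)
    · exact Or.inr (h.exists_eq (by omega) h0)
    · omega
  · intro _
    rcases key with h | h | ⟨-, x, a, b, ha, hb, h⟩
    · exact Or.inl (h.exists_eq h0)
    · exact Or.inr (Or.inl (h.exists_eq (by omega) h0))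
    · refine Or.inr (Or.inr ⟨x, a, b, Nat.pos_of_ne_zero ?_, ha, hb, h⟩)
      exact ne_of_mem_of_not_mem (by rw [h]; exact Finset.mem_insert_self _ _) h0
end

section
/- Let N be an odd positive integer and let S be a sum-free (0-closed) subset of [1,N] of maximum size ⌈N/2⌉ = (N+1)/2. Then S is an arithmetic progression with common difference 1 or 2; explicitly, S = [(N+1)/2, N] or S = {1, 3, 5, ..., N}. -/
theorem rval_eq_zero_iff (S : Finset ℕ) :
    rval S = 0 ↔ ∀ x ∈ S, ∀ y ∈ S, x + y ∉ S := by
  simp only [rval, Finset.card_eq_zero, Finset.filter_eq_empty_iff, Finset.mem_product,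
    Prod.forall]
  exact ⟨fun h x hx y hy => h x y ⟨hx, hy⟩, fun h x y hxy => h x hxy.1 y hxy.2⟩

/-- In a sum-free set of positive integers with largest element `m`, the elements below `m` and
their reflections `m - x` are disjoint subsets of `[1, m - 1]`. -/
theorem reflection_of_sum_free (S : Finset ℕ) (m : ℕ) (hpos : ∀ x ∈ S, 0 < x) (hm : m ∈ S)
    (hmax : ∀ x ∈ S, x ≤ m) (hfree : ∀ x ∈ S, ∀ y ∈ S, x + y ∉ S) :
    S.erase m ∪ (S.erase m).image (m - ·) ⊆ Finset.Icc 1 (m - 1) ∧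
      (S.erase m ∪ (S.erase m).image (m - ·)).card = 2 * (S.card - 1) := by
  have hlt : ∀ x ∈ S.erase m, x ∈ S ∧ 0 < x ∧ x < m := fun x hx => by
    obtain ⟨hne, hxS⟩ := Finset.mem_erase.1 hx
    exact ⟨hxS, hpos x hxS, lt_of_le_of_ne (hmax x hxS) hne⟩
  constructor
  · intro y hy
    rw [Finset.mem_Icc]
    rcases Finset.mem_union.1 hy with hy | hy
    · have := hlt y hy
      omega
    · obtain ⟨x, hx, rfl⟩ := Finset.mem_image.1 hy
      have := hlt x hx
      omega
  · rw [Finset.card_union_of_disjoint, Finset.card_image_of_injOn, Finset.card_erase_of_mem hm]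
    · omega
    · intro x hx y hy hxy
      have := hlt x hx
      have := hlt y hy
      dsimp only at hxy
      omega
    · rw [Finset.disjoint_left]
      intro y hy hy'
      obtain ⟨x, hx, rfl⟩ := Finset.mem_image.1 hy'
      have hxm := hlt x hx
      refine hfree x hxm.1 _ (hlt _ hy).1 ?_
      rwa [Nat.add_sub_cancel' hxm.2.2.le]

/-- A sum-free subset of `[1, N]` of size `(N + 1) / 2`, `N` odd, contains `N` and meets every
pair `{x, N - x}`. -/
theorem mem_or_sub_mem_of_card_eq (N : ℕ) (hodd : Odd N) (S : Finset ℕ)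
    (hS : S ⊆ Finset.Icc 1 N) (hfree : ∀ x ∈ S, ∀ y ∈ S, x + y ∉ S)
    (hcard : S.card = (N + 1) / 2) :
    N ∈ S ∧ ∀ x, 0 < x → x < N → x ∈ S ∨ N - x ∈ S := by
  obtain ⟨k, rfl⟩ := hodd
  have hne : S.Nonempty := Finset.card_pos.1 (by omega)
  have hpos : ∀ x ∈ S, 0 < x := fun x hx => (Finset.mem_Icc.1 (hS hx)).1
  obtain ⟨m, hm, hmax⟩ := S.exists_max_image id hne
  obtain ⟨hsub, hc⟩ := reflection_of_sum_free S m hpos hm hmax hfree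
  have hle := Finset.card_le_card hsub
  have hmN := (Finset.mem_Icc.1 (hS hm)).2
  have hmpos := hpos m hm
  rw [Nat.card_Icc] at hle
  obtain rfl : m = 2 * k + 1 := by omega
  have heq := Finset.eq_of_subset_of_card_le hsub (by rw [Nat.card_Icc]; omega)
  refine ⟨hm, fun x hx hxN => ?_⟩
  have hx' : x ∈ Finset.Icc 1 (2 * k + 1 - 1) := Finset.mem_Icc.2 (by omega)
  rw [← heq, Finset.mem_union] at hx'
  rcases hx' with hx' | hx'
  · exact Or.inl (Finset.mem_of_mem_erase hx')
  · obtain ⟨y, hy, rfl⟩ := Finset.mem_image.1 hx'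
    have hyS := Finset.mem_of_mem_erase hy
    have hyle := hmax y hyS
    simp only [id] at hyle
    right
    rwa [Nat.sub_sub_self hyle]

/-- Proposition 4.4: for odd `N`, a sum-free subset of `[1,N]` of maximum size
`(N+1)/2` is either the interval `[(N+1)/2, N]` or the odd numbers `{1,3,…,N}`. -/
theorem maximal_sumfree_odd (N : ℕ) (hN : 0 < N) (hodd : Odd N) (S : Finset ℕ)
    (hS : S ⊆ Finset.Icc 1 N) (hr : rval S = 0) (hcard : S.card = (N + 1) / 2) :
    S = Finset.Icc ((N + 1) / 2) N ∨
      S = (Finset.range ((N + 1) / 2)).image (fun k => 2 * k + 1) := by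
  have hfree := (rval_eq_zero_iff S).1 hr
  obtain ⟨hNS, hpair⟩ := mem_or_sub_mem_of_card_eq N hodd S hS hfree hcard
  have hpos : ∀ x ∈ S, 0 < x ∧ x ≤ N := fun x hx => Finset.mem_Icc.1 (hS hx)
  have hshift : ∀ x ∈ S, ∀ z, 0 < z → x + z < N → z ∉ S → x + z ∈ S := by
    intro x hx z hz hlt hzS
    by_contra hxz
    have h1 := (hpair z hz (by omega)).resolve_left hzS
    have h2 := (hpair (x + z) (by omega) hlt).resolve_left hxz
    refine hfree x hx _ h2 ?_
    rwa [show x + (N - (x + z)) = N - z by omega]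
  obtain ⟨d, hd, hmin⟩ := S.exists_min_image id ⟨N, hNS⟩
  simp only [id] at hmin
  have hdN := hpos d hd
  have hdouble := hfree d hd d hd
  obtain ⟨n, rfl⟩ := hodd
  by_cases hd1 : d = 1
  · subst hd1
    right
    refine Finset.eq_of_subset_of_card_le (fun x hx => ?_) ?_
    · have hoddmem : ∀ k, 2 * k + 1 ≤ 2 * n + 1 → 2 * k + 1 ∈ S := by
        intro k
        induction k with
        | zero => exact fun _ => hd
        | succ k ih =>
          intro hk
          rcases Nat.eq_or_lt_of_le hk with h | h
          · rwa [h]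
          · have := hfree 1 hd _ (ih (by omega))
            have := hshift 1 hd _ (by omega) (by omega) this
            rwa [show 2 * (k + 1) + 1 = 1 + (1 + (2 * k + 1)) by ring]
      have hxN := hpos x hx
      rcases Nat.even_or_odd' x with ⟨k, rfl | rfl⟩
      · have := hfree 1 hd _ (hoddmem (k - 1) (by omega))
        rw [show 1 + (2 * (k - 1) + 1) = 2 * k by omega] at this
        exact absurd hx this
      · exact Finset.mem_image.2 ⟨k, Finset.mem_range.2 (by omega), rfl⟩
    · rw [hcard]
      exact Finset.card_image_le.trans (Finset.card_range _).le
  · left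
    have hNlt : 2 * n + 1 < 2 * d := by
      by_contra hge
      have hcompl := (hpair (d + d) (by omega) (by omega)).resolve_left hdouble
      have hle := hmin _ hcompl
      have hsucc : d + 1 ∈ S :=
        hshift d hd 1 one_pos (by omega) fun h => by have := hmin 1 h; omega
      have hpred : d + (d - 1) ∈ S :=
        hshift d hd (d - 1) (by omega) (by omega) fun h => by have := hmin _ h; omega
      have htriple : d + (d + d) ∈ S := by
        rcases Nat.eq_or_lt_of_le (show d + (d + d) ≤ 2 * n + 1 by omega) with h | h
        · rwa [h]
        · exact hshift d hd _ (by omega) h hdouble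
      refine hfree _ hsucc _ hpred ?_
      rwa [show d + 1 + (d + (d - 1)) = d + (d + d) by omega]
    refine Finset.eq_of_subset_of_card_le (fun x hx => ?_) ?_
    · have := hmin x hx
      have := hpos x hx
      exact Finset.mem_Icc.2 (by omega)
    · rw [hcard, Nat.card_Icc]
      omega
end

section
/- Let N be an even positive integer with N > 8, and let S be a sum-free (0-closed) subset of [1,N] of maximum size N/2. Then S is an arithmetic progression with common difference 1 or 2. -/
/-- A sum-free set with maximum `M` is disjoint from its reflection `x ↦ M - x`, which bounds its
size once a set `F` avoided by both is removed. -/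
lemma two_mul_card_erase_add_card_le {S F : Finset ℕ} {M : ℕ} (hM : M ∈ S)
    (hpos : ∀ x ∈ S, 1 ≤ x) (hmax : ∀ x ∈ S, x ≤ M) (hsf : ∀ x ∈ S, ∀ y ∈ S, x + y ∉ S)
    (hF : F ⊆ Finset.Ioo 0 M) (hFS : ∀ x ∈ F, x ∉ S ∧ M - x ∉ S) :
    2 * (S.card - 1) + F.card ≤ M - 1 := by
  classical
  set T := S.erase M with hT
  have hTlt : ∀ x ∈ T, x ∈ S ∧ 1 ≤ x ∧ x < M := by
    intro x hx
    rw [hT, Finset.mem_erase] at hx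
    have := hmax x hx.2
    exact ⟨hx.2, hpos x hx.2, by omega⟩
  have hcT : T.card = S.card - 1 := Finset.card_erase_of_mem hM
  have hcI : (T.image (M - ·)).card = T.card := by
    apply Finset.card_image_of_injOn
    intro a ha b hb hab
    have := hTlt a ha
    have := hTlt b hb
    simp only at hab
    omega
  have hd : Disjoint T (T.image (M - ·)) := by
    rw [Finset.disjoint_left]
    intro a ha hb
    obtain ⟨b, hbT, rfl⟩ := Finset.mem_image.1 hb
    have h1 := hTlt _ ha
    have h2 := hTlt b hbT
    apply hsf _ h1.1 b h2.1
    rwa [Nat.sub_add_cancel h2.2.2.le]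
  have hd' : Disjoint (T ∪ T.image (M - ·)) F := by
    rw [Finset.disjoint_left]
    intro a ha hb
    have h1 := hFS a hb
    rcases Finset.mem_union.1 ha with ha | ha
    · exact h1.1 (hTlt a ha).1
    · obtain ⟨b, hbT, rfl⟩ := Finset.mem_image.1 ha
      have h2 := hTlt b hbT
      apply h1.2
      rw [Nat.sub_sub_self h2.2.2.le]
      exact h2.1
  have hsub : T ∪ T.image (M - ·) ∪ F ⊆ Finset.Ioo 0 M := by
    refine Finset.union_subset (Finset.union_subset ?_ ?_) hF
    · intro a ha
      have := hTlt a ha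
      rw [Finset.mem_Ioo]
      omega
    · intro a ha
      obtain ⟨b, hb, rfl⟩ := Finset.mem_image.1 ha
      have := hTlt b hb
      rw [Finset.mem_Ioo]
      omega
  have h := Finset.card_le_card hsub
  rw [Finset.card_union_of_disjoint hd', Finset.card_union_of_disjoint hd, hcI, hcT,
    Nat.card_Ioo] at h
  omega

lemma eq_image_range_of_subset {S : Finset ℕ} {n x d : ℕ} (hcard : S.card = n)
    (h : ∀ y ∈ S, ∃ k < n, x + k * d = y) :
    S = (Finset.range n).image (fun k => x + k * d) := by
  apply Finset.eq_of_subset_of_card_le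
  · intro y hy
    obtain ⟨k, hk, rfl⟩ := h y hy
    exact Finset.mem_image.2 ⟨k, Finset.mem_range.2 hk, rfl⟩
  · rw [hcard]
    exact Finset.card_image_le.trans (Finset.card_range n).le

/-- If the minimum `m` of a sum-free set containing one of `x`, `M - x` whenever `x ≠ M / 2`
satisfies `m < M / 2`, then the set contains `[m, 2m - 1]` apart from `M / 2`. -/
lemma mem_of_lt_two_mul_min {S : Finset ℕ} {m M : ℕ} (hm : m ∈ S) (hm0 : 1 ≤ m)
    (hmin : ∀ x ∈ S, m ≤ x) (hsf : ∀ x ∈ S, ∀ y ∈ S, x + y ∉ S)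
    (hpair : ∀ x, 1 ≤ x → x < M → 2 * x ≠ M → x ∉ S → M - x ∈ S) (hmM : 2 * m < M)
    {y : ℕ} (h1 : m ≤ y) (h2 : y < 2 * m) (h3 : 2 * y ≠ M) : y ∈ S := by
  by_contra hy
  have h4 := hpair y (by omega) (by omega) h3 hy
  have h5 := hsf _ h4 m hm
  rcases Nat.eq_or_lt_of_le h1 with rfl | h1
  · exact hy hm
  · have h6 : y - m ∉ S := fun h => by have := hmin _ h; omega
    have h7 := hpair (y - m) (by omega) (by omega) (by omega) h6
    rw [show M - (y - m) = M - y + m by omega] at h7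
    exact h5 h7

lemma odd_max_le_two_mul_min {S : Finset ℕ} {m M : ℕ} (hm : m ∈ S) (hM : M ∈ S) (hm2 : 2 ≤ m)
    (hodd : Odd M) (hmin : ∀ x ∈ S, m ≤ x) (hsf : ∀ x ∈ S, ∀ y ∈ S, x + y ∉ S)
    (hpair : ∀ x, 1 ≤ x → x < M → 2 * x ≠ M → x ∉ S → M - x ∈ S) : M ≤ 2 * m := by
  by_contra! hmM
  obtain ⟨j, hj⟩ := hodd
  have hlow : ∀ y, m ≤ y → y < 2 * m → y ∈ S := fun y h1 h2 =>
    mem_of_lt_two_mul_min hm (by omega) hmin hsf hpair hmM h1 h2 (by omega)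
  have h2m : 2 * m ∉ S := by
    have := hsf m hm m hm
    rwa [← two_mul] at this
  have h3m : 3 * m ∉ S := by
    have := hsf (m + 1) (hlow _ (by omega) (by omega)) (2 * m - 1) (hlow _ (by omega) (by omega))
    rwa [show m + 1 + (2 * m - 1) = 3 * m by omega] at this
  rcases lt_trichotomy (3 * m) M with h | h | h
  · have h1 := hpair (3 * m) (by omega) h (by omega) h3m
    have h2 := hpair (2 * m) (by omega) (by omega) (by omega) h2m
    apply hsf _ h1 m hm
    rwa [show M - 3 * m + m = M - 2 * m by omega]
  · exact h3m (h ▸ hM)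
  · apply hsf m hm (M - m) (hlow _ (by omega) (by omega))
    rwa [show m + (M - m) = M by omega]

lemma half_even_max_le_min {S : Finset ℕ} {m n : ℕ} (hn : 5 ≤ n) (hm : m ∈ S)
    (hM : 2 * n ∈ S) (hm2 : 2 ≤ m)
    (hmin : ∀ x ∈ S, m ≤ x) (hsf : ∀ x ∈ S, ∀ y ∈ S, x + y ∉ S)
    (hpair : ∀ x, 1 ≤ x → x < 2 * n → x ≠ n → x ∉ S → 2 * n - x ∈ S) : n ≤ m := by
  by_contra! hmn
  have hlow : ∀ y, m ≤ y → y < 2 * m → y ≠ n → y ∈ S := fun y h1 h2 h3 =>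
    mem_of_lt_two_mul_min hm (by omega) hmin hsf (fun x a b c => hpair x a b (by omega))
      (by omega) h1 h2 (by omega)
  have hsum : ∀ a b c, a ∈ S → b ∈ S → c ∈ S → a + b ≠ c := by
    rintro a b c ha hb hc rfl
    exact hsf a ha b hb hc
  have hhigh : ∀ x, 1 ≤ x → x < m → 2 * n - x ∈ S := fun x h1 h2 =>
    hpair x h1 (by omega) (by omega) fun h => by have := hmin x h; omega
  have hrefl : ∀ a b c, a ∈ S → b ∈ S → a + b = c → c < 2 * n → c ≠ n → 2 * n - c ∈ S := by
    rintro a b c ha hb rfl h1 h2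
    have := hmin a ha
    exact hpair _ (by omega) h1 h2 (hsf a ha b hb)
  rcases lt_trichotomy (2 * m) n with h | h | h
  · have hm1 := hlow (m + 1) (by omega) (by omega) (by omega)
    have hl := hlow (2 * m - 1) (by omega) (by omega) (by omega)
    by_cases h3 : 3 * m = n
    · have h1 := hrefl m (m + 1) (2 * m + 1) hm hm1 (by omega) (by omega) (by omega)
      rcases Nat.eq_or_lt_of_le hm2 with rfl | hm3
      · have h4 := hrefl 2 2 4 hm hm rfl (by omega) (by omega)
        have h5 := hhigh 1 le_rfl (by omega)
        exact hsum _ _ _ hm1 h4 h5 (by omega)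
      · have h4 := hrefl (m + 2) (2 * m - 1) (3 * m + 1) (hlow _ (by omega) (by omega) (by omega))
          hl (by omega) (by omega) (by omega)
        exact hsum _ _ _ hm h4 h1 (by omega)
    · have h1 := hrefl m m (2 * m) hm hm (by omega) (by omega) (by omega)
      have h2 := hrefl (m + 1) (2 * m - 1) (3 * m) hm1 hl (by omega) (by omega) h3
      exact hsum _ _ _ hm h2 h1 (by omega)
  · exact hsum (m + 2) (2 * m - 1) (2 * n - (m - 1)) (hlow _ (by omega) (by omega) (by omega))
      (hlow _ (by omega) (by omega) (by omega)) (hhigh _ (by omega) (by omega)) (by omega)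
  · by_cases h2 : 2 * m = n + 1
    · exact hsum (m + 1) (2 * m - 2) (2 * n - (m - 1)) (hlow _ (by omega) (by omega) (by omega))
        (hlow _ (by omega) (by omega) (by omega)) (hhigh _ (by omega) (by omega)) (by omega)
    · exact hsum (n - 1) (n + 1) (2 * n) (hlow _ (by omega) (by omega) (by omega))
        (hlow _ (by omega) (by omega) (by omega)) hM (by omega)

lemma one_notMem_of_even_max {S : Finset ℕ} {n : ℕ} (hn : 5 ≤ n) (hM : 2 * n ∈ S)
    (hsf : ∀ x ∈ S, ∀ y ∈ S, x + y ∉ S)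
    (hpair : ∀ x, 1 ≤ x → x < 2 * n → x ≠ n → x ∉ S → 2 * n - x ∈ S) : 1 ∉ S := by
  intro h1
  have key : ∀ k, 2 * k + 1 < n →
      2 * k + 1 ∈ S ∧ (2 * k + 2 < n → 2 * n - (2 * k + 2) ∈ S) := by
    intro k
    induction k with
    | zero =>
      intro _
      exact ⟨h1, fun _ => hpair 2 (by omega) (by omega) (by omega) (hsf 1 h1 1 h1)⟩
    | succ k ih =>
      intro hk
      obtain ⟨-, hb⟩ := ih (by omega)
      have h3 : 2 * (k + 1) + 1 ∈ S := by
        by_contra h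
        have h4 := hpair _ (by omega) (by omega) (by omega) h
        apply hsf _ h4 1 h1
        rw [show 2 * n - (2 * (k + 1) + 1) + 1 = 2 * n - (2 * k + 2) by omega]
        exact hb (by omega)
      exact ⟨h3, fun h => hpair _ (by omega) (by omega) (by omega) (hsf _ h3 1 h1)⟩
  rcases Nat.even_or_odd' n with ⟨j, rfl | rfl⟩
  · have ha := (key (j - 1) (by omega)).1
    have hb := (key 0 (by omega)).2 (by omega)
    apply hsf _ ha _ ha
    convert hb using 1
    omega
  · have ha := (key (j - 1) (by omega)).1
    have hb := (key 1 (by omega)).2 (by omega)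
    apply hsf _ ha _ ha
    convert hb using 1
    omega

lemma odd_of_mem_of_odd_max {S : Finset ℕ} {M : ℕ} (h1 : 1 ∈ S) (hodd : Odd M)
    (hpos : ∀ x ∈ S, 1 ≤ x) (hmax : ∀ x ∈ S, x ≤ M)
    (hsf : ∀ x ∈ S, ∀ y ∈ S, x + y ∉ S) (hM : M ∈ S)
    (hpair : ∀ x, 1 ≤ x → x < M → 2 * x ≠ M → x ∉ S → M - x ∈ S) :
    ∀ x ∈ S, Odd x := by
  obtain ⟨j, rfl⟩ := hodd
  have key : ∀ k, k ≤ j → 2 * k + 1 ∈ S := by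
    intro k
    induction k with
    | zero => exact fun _ => h1
    | succ k ih =>
      intro hk
      rcases Nat.eq_or_lt_of_le hk with h | h
      · rwa [h]
      · by_contra hc
        have h2 := hsf _ (ih (by omega)) 1 h1
        have h3 := hpair _ (by omega) (by omega) (by omega) hc
        have h4 := hpair _ (by omega) (by omega) (by omega) h2
        apply hsf _ h3 1 h1
        convert h4 using 1
        omega
  intro x hx
  by_contra hne
  obtain ⟨i, hi⟩ := Nat.not_odd_iff_even.1 hne
  have := hpos x hx
  have := hmax x hx
  apply hsf _ (key (i - 1) (by omega)) 1 h1
  convert hx using 1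
  omega

/-- Proposition 4.5: for even `N > 8`, a sum-free subset of `[1,N]` of maximum size
`N/2` is an arithmetic progression with common difference 1 or 2. -/
theorem maximal_sumfree_even (N : ℕ) (heven : Even N) (hN : 8 < N) (S : Finset ℕ)
    (hS : S ⊆ Finset.Icc 1 N) (hr : rval S = 0) (hcard : S.card = N / 2) :
    ∃ x d : ℕ, 0 < x ∧ (d = 1 ∨ d = 2) ∧
      S = (Finset.range (N / 2)).image (fun k => x + k * d) := by
  obtain ⟨n, hn⟩ := heven
  have hNn : N / 2 = n := by omega
  rw [hNn] at hcard ⊢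
  have hsf : ∀ x ∈ S, ∀ y ∈ S, x + y ∉ S := by
    intro x hx y hy hxy
    rw [rval, Finset.card_eq_zero] at hr
    have : (x, y) ∈ (S ×ˢ S).filter (fun p => p.1 + p.2 ∈ S) := by simp [hx, hy, hxy]
    rw [hr] at this
    exact Finset.notMem_empty _ this
  have hne : S.Nonempty := Finset.card_pos.1 (by omega)
  have hpos : ∀ x ∈ S, 1 ≤ x := fun x hx => (Finset.mem_Icc.1 (hS hx)).1
  obtain ⟨M, hM, hmax⟩ := S.exists_max_image id hne
  obtain ⟨m, hm, hmin⟩ := S.exists_min_image id hne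
  simp only [id] at hmax hmin
  have hMN : M ≤ N := (Finset.mem_Icc.1 (hS hM)).2
  have hm1 := hpos m hm
  have hlow : 2 * n - 1 ≤ M := by
    have := two_mul_card_erase_add_card_le (F := ∅) hM hpos hmax hsf (by simp) (by simp)
    rw [hcard, Finset.card_empty] at this
    omega
  have hpair : ∀ x, 1 ≤ x → x < M → 2 * x ≠ M → x ∉ S → M - x ∈ S := by
    intro x h1 h2 h3 h4
    by_contra h5
    have := two_mul_card_erase_add_card_le (F := {x, M - x}) hM hpos hmax hsf
      (by
        intro y hy
        simp only [Finset.mem_insert, Finset.mem_singleton] at hy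
        rw [Finset.mem_Ioo]
        omega)
      (by
        intro y hy
        simp only [Finset.mem_insert, Finset.mem_singleton] at hy
        rcases hy with rfl | rfl
        · exact ⟨h4, h5⟩
        · rw [Nat.sub_sub_self h2.le]
          exact ⟨h5, h4⟩)
    rw [hcard, Finset.card_pair (by omega)] at this
    omega
  obtain hMn | hMn : M = 2 * n ∨ M = 2 * n - 1 := by omega
  · subst hMn
    have hpair' : ∀ x, 1 ≤ x → x < 2 * n → x ≠ n → x ∉ S → 2 * n - x ∈ S :=
      fun x a b c => hpair x a b (by omega)
    have h1S := one_notMem_of_even_max (by omega) hM hsf hpair'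
    have hm2 : m ≠ 1 := fun h => h1S (h ▸ hm)
    have hnm := half_even_max_le_min (by omega) hm hM (by omega) hmin hsf hpair'
    have hnS : n ∉ S := fun h => hsf n h n h (by rwa [← two_mul])
    refine ⟨n + 1, 1, by omega, Or.inl rfl, eq_image_range_of_subset hcard ?_⟩
    intro y hy
    have hyn : y ≠ n := fun h => hnS (h ▸ hy)
    have := hmin y hy
    have := hmax y hy
    exact ⟨y - (n + 1), by omega, by omega⟩
  · have hodd : Odd M := ⟨n - 1, by omega⟩
    rcases Nat.eq_or_lt_of_le hm1 with h | h
    · subst h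
      refine ⟨1, 2, by omega, Or.inr rfl, eq_image_range_of_subset hcard ?_⟩
      intro y hy
      obtain ⟨k, hk⟩ := odd_of_mem_of_odd_max hm hodd hpos hmax hsf hM hpair y hy
      have := hmax y hy
      exact ⟨k, by omega, by omega⟩
    · have hnm := odd_max_le_two_mul_min hm hM h hodd hmin hsf hpair
      refine ⟨n, 1, by omega, Or.inl rfl, eq_image_range_of_subset hcard ?_⟩
      intro y hy
      have := hmin y hy
      have := hmax y hy
      exact ⟨y - n, by omega, by omega⟩
end

section
/- Let s > 3 and N = 2s − 2. Then there exists no subset S ⊆ [1,N] of size s with r(S) = 2. -/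
/-- The elements `x ∈ S` for which `z - x` is again a (positive) element of `S`. -/
def summands (S : Finset ℕ) (z : ℕ) : Finset ℕ :=
  S.filter (fun x => x ≤ z ∧ z - x ∈ S)

theorem mem_summands {S : Finset ℕ} {x y z : ℕ} (hx : x ∈ S) (hy : y ∈ S) (h : x + y = z) :
    x ∈ summands S z := by
  subst h
  simp [summands, hx, hy]

theorem sum_card_summands_le_rval {S Z : Finset ℕ} (hZ : Z ⊆ S) :
    ∑ z ∈ Z, (summands S z).card ≤ rval S := by
  rw [← Finset.card_sigma]
  refine Finset.card_le_card_of_injOn (fun p => (p.2, p.1 - p.2)) ?_ ?_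
  · rintro ⟨z, x⟩ h
    simp only [summands, Finset.coe_sigma, Set.mem_sigma_iff, Finset.mem_coe,
      Finset.mem_filter] at h
    obtain ⟨hz, hx, hxz, hy⟩ := h
    simp only [Finset.coe_filter, Finset.mem_product, Set.mem_ofPred_eq]
    rw [Nat.add_sub_cancel' hxz]
    exact ⟨⟨hx, hy⟩, hZ hz⟩
  · rintro ⟨z, x⟩ h ⟨w, y⟩ h' heq
    simp only [summands, Finset.coe_sigma, Set.mem_sigma_iff, Finset.mem_coe,
      Finset.mem_filter] at h h'
    simp only [Prod.mk.injEq] at heq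
    obtain ⟨rfl, h2⟩ := heq
    obtain rfl : z = w := by omega
    rfl

/-- Pigeonhole for the reflection `x ↦ z - x` of `[1, z - 1]`; `U` collects points missed by
`S` and by its reflection. -/
theorem two_mul_card_add_card_lt {S U : Finset ℕ} {z : ℕ} (h0 : 0 ∉ S) (hz : 0 < z)
    (hU : ∀ u ∈ U, 0 < u ∧ u < z ∧ u ∉ S ∧ z - u ∉ S) :
    2 * (S.filter (· < z)).card + U.card < z + (summands S z).card := by
  set T := S.filter (· < z) with hT
  set T' := T.image (fun x => z - x) with hT'
  have hpos : ∀ x ∈ S, 0 < x := fun x hx => Nat.pos_of_ne_zero (fun h => h0 (h ▸ hx))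
  have hcard : T'.card = T.card := by
    refine Finset.card_image_of_injOn ?_
    intro x hx y hy hxy
    simp only [hT, Finset.coe_filter, Set.mem_ofPred_eq] at hx hy hxy
    omega
  have hinter : T ∩ T' ⊆ summands S z := by
    intro x hx
    simp only [hT, hT', Finset.mem_inter, Finset.mem_image, Finset.mem_filter] at hx
    obtain ⟨⟨hx, hxz⟩, y, ⟨hy, hyz⟩, rfl⟩ := hx
    exact mem_summands hx hy (by omega)
  have hdisj : Disjoint (T ∪ T') U := by
    rw [Finset.disjoint_right]
    intro u hu hmem
    obtain ⟨h1, h2, h3, h4⟩ := hU u hu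
    simp only [hT, hT', Finset.mem_union, Finset.mem_image, Finset.mem_filter] at hmem
    rcases hmem with h | ⟨y, ⟨hy, hyz⟩, rfl⟩
    · exact h3 h.1
    · exact h4 (by rwa [Nat.sub_sub_self hyz.le])
  have hsub : (T ∪ T') ∪ U ⊆ Finset.Ico 1 z := by
    intro u hu
    simp only [hT, hT', Finset.mem_union, Finset.mem_image, Finset.mem_filter] at hu
    rw [Finset.mem_Ico]
    rcases hu with (h | ⟨y, ⟨hy, hyz⟩, rfl⟩) | h
    · exact ⟨hpos u h.1, h.2⟩
    · have := hpos y hy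
      omega
    · exact ⟨(hU u h).1, (hU u h).2.1⟩
  have h1 := Finset.card_le_card hsub
  rw [Finset.card_union_of_disjoint hdisj, Nat.card_Ico] at h1
  have h2 := Finset.card_union_add_card_inter T T'
  have h3 := Finset.card_le_card hinter
  omega

theorem rval_ne_two {S : Finset ℕ} {n : ℕ} (hn : 3 ≤ n) (hS : S ⊆ Finset.Icc 1 (2 * n))
    (hcard : S.card = n + 1) : rval S ≠ 2 := by
  intro hr
  have hbd : ∀ x ∈ S, 1 ≤ x ∧ x ≤ 2 * n := fun x hx => Finset.mem_Icc.1 (hS hx)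
  have h0 : 0 ∉ S := fun h => by have := hbd 0 h; omega
  have hpair : ∀ z ∈ S, ∀ w ∈ S, z ≠ w →
      (summands S z).card + (summands S w).card ≤ 2 := by
    intro z hz w hw hzw
    have h := sum_card_summands_le_rval (S := S) (Z := {z, w})
      (Finset.insert_subset hz (Finset.singleton_subset_iff.2 hw))
    rwa [Finset.sum_pair hzw, hr] at h
  have hone : ∀ x ∈ S, ∀ y ∈ S, 1 ≤ (summands S (x + y)).card := fun x hx y hy =>
    Finset.card_pos.2 ⟨x, mem_summands hx hy rfl⟩
  have htwo : ∀ x ∈ S, ∀ y ∈ S, x ≠ y → 2 ≤ (summands S (x + y)).card := fun x hx y hy hxy =>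
    Finset.one_lt_card.2 ⟨x, mem_summands hx hy rfl, y, mem_summands hy hx (add_comm y x), hxy⟩
  -- the two largest elements
  obtain ⟨m, hm, hmax⟩ := S.exists_max_image id (Finset.card_pos.1 (by omega))
  simp only [id] at hmax
  have hTm : (S.filter (· < m)) = S.erase m := by
    ext x
    simp only [Finset.mem_filter, Finset.mem_erase]
    exact ⟨fun h => ⟨h.2.ne, h.1⟩, fun h => ⟨h.2, lt_of_le_of_ne (hmax x h.2) h.1⟩⟩
  have hTmc : (S.filter (· < m)).card = n := by
    rw [hTm, Finset.card_erase_of_mem hm, hcard]; rfl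
  obtain ⟨m', hm', hmax'⟩ := (S.erase m).exists_max_image id
    (Finset.card_pos.1 (by rw [← hTm, hTmc]; omega))
  simp only [id] at hmax'
  have hm'S := Finset.mem_of_mem_erase hm'
  have hlt : m' < m := lt_of_le_of_ne (hmax _ hm'S) (Finset.ne_of_mem_erase hm')
  have hTm' : (S.filter (· < m')) = (S.erase m).erase m' := by
    ext x
    simp only [Finset.mem_filter, Finset.mem_erase]
    constructor
    · rintro ⟨h1, h2⟩
      exact ⟨h2.ne, (h2.trans hlt).ne, h1⟩
    · rintro ⟨h1, h2, h3⟩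
      exact ⟨h3, lt_of_le_of_ne (hmax' x (Finset.mem_erase.2 ⟨h2, h3⟩)) h1⟩
  have hTmc' : (S.filter (· < m')).card + 1 = n := by
    rw [hTm', Finset.card_erase_of_mem hm', ← hTm, hTmc]; omega
  have key := fun U => two_mul_card_add_card_lt (S := S) (U := U) (z := m) h0 (hbd m hm).1
  have key' := fun U => two_mul_card_add_card_lt (S := S) (U := U) (z := m') h0 (hbd m' hm'S).1
  rw [hTmc] at key
  have e1 := key ∅ (by simp)
  have e2 := key' ∅ (by simp)
  have e3 := hpair m hm m' hm'S hlt.ne'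
  have b1 := hbd m hm
  simp only [Finset.card_empty] at e1 e2
  obtain rfl : m = 2 * n := by omega
  have hmis : ∀ a b, a + b = 2 * n → 1 ≤ a → a < b → a ∉ S → b ∉ S →
      3 ≤ (summands S (2 * n)).card := by
    intro a b hab ha hlt ha' hb'
    have ea : 2 * n - a = b := by omega
    have eb : 2 * n - b = a := by omega
    have := key {a, b} (by
      simp only [Finset.mem_insert, Finset.mem_singleton]
      rintro u (rfl | rfl)
      · exact ⟨by omega, by omega, ha', by rwa [ea]⟩
      · exact ⟨by omega, by omega, hb', by rwa [eb]⟩)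
    rw [Finset.card_pair hlt.ne] at this
    omega
  have hmid : n ∉ S → 2 ≤ (summands S (2 * n)).card := by
    intro h
    have en : 2 * n - n = n := by omega
    have := key {n} (by
      simp only [Finset.mem_singleton]
      rintro u rfl
      exact ⟨by omega, by omega, h, by rwa [en]⟩)
    rw [Finset.card_singleton] at this
    omega
  by_cases hnS : n ∈ S
  · have hsmall : ∀ k ∈ S, n ≤ k := by
      by_contra! hk
      obtain ⟨k, hk, hkn⟩ := hk
      have hk1 := (hbd k hk).1
      have huniq : ∀ j ∈ S, j < n → 2 * j = n := by
        intro j hj hjn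
        have hj1 := (hbd j hj).1
        have h1 : n + j ∉ S := fun h => by
          have := htwo n hnS j hj hjn.ne'
          have := hpair _ h _ hm (by omega)
          omega
        have h2 : n - j ∈ S := by
          by_contra h
          have := hmis (n - j) (n + j) (by omega) (by omega) (by omega) h h1
          omega
        by_contra h
        have h3 := htwo j hj (n - j) h2 (by omega)
        rw [Nat.add_sub_cancel' hjn.le] at h3
        have := hpair _ hnS _ hm (by omega)
        omega
      have hk2 := huniq k hk hkn
      have h1 : n + 1 ∈ S := by
        by_contra h
        have := hmis (n - 1) (n + 1) (by omega) (by omega) (by omega)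
          (fun h' => by have := huniq _ h' (by omega); omega) h
        omega
      have h2 : k + (n + 1) ∈ S := by
        by_contra h
        have := hmis (k - 1) (k + (n + 1)) (by omega) (by omega) (by omega)
          (fun h' => by have := huniq _ h' (by omega); omega) h
        omega
      have := htwo k hk (n + 1) h1 (by omega)
      have := hpair _ h2 _ hm (by omega)
      omega
    have hle : rval S ≤ ({(n, n)} : Finset (ℕ × ℕ)).card := by
      refine Finset.card_le_card ?_
      rintro ⟨x, y⟩ h
      simp only [Finset.mem_filter, Finset.mem_product] at h
      have := hsmall x h.1.1
      have := hsmall y h.1.2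
      have := hbd _ h.2
      rw [Finset.mem_singleton, Prod.mk.injEq]
      omega
    rw [Finset.card_singleton] at hle
    omega
  · have h2 := hmid hnS
    obtain rfl : m' = 2 * n - 1 := by omega
    have hmis' : ∀ a b, a + b = 2 * n - 1 → 1 ≤ a → 1 ≤ b → a ∉ S → b ∈ S := by
      intro a b hab ha hb ha'
      by_contra hb'
      have ea : 2 * n - 1 - a = b := by omega
      have := key' {a} (by
        simp only [Finset.mem_singleton]
        rintro u rfl
        exact ⟨by omega, by omega, ha', by rwa [ea]⟩)
      rw [Finset.card_singleton] at this
      omega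
    have hfree : ∀ x ∈ S, x < n → x + x ∉ S := by
      intro x hx hxn h
      have := hone x hx x hx
      have := hpair _ h _ hm (by omega)
      omega
    have h3 : n - 1 ∈ S := hmis' n (n - 1) (by omega) (by omega) (by omega) hnS
    have h4 : 2 * n - 2 ∉ S := by
      have := hfree _ h3 (by omega)
      rwa [show n - 1 + (n - 1) = 2 * n - 2 by omega] at this
    have h5 : 1 ∈ S := hmis' (2 * n - 2) 1 (by omega) (by omega) (by omega) h4
    have h6 : 2 ∉ S := hfree 1 h5 (by omega)
    have := hmis 2 (2 * n - 2) (by omega) (by omega) (by omega) h6 h4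
    omega

/-- Theorem 4.7: for `N = 2s − 2` with `s > 3`, no `s`-element subset of `[1,N]`
has `r`-value `2`. -/
theorem no_rval_two (s N : ℕ) (hs : 3 < s) (hN : N = 2 * s - 2) :
    ¬ ∃ S : Finset ℕ, S ⊆ Finset.Icc 1 N ∧ S.card = s ∧ rval S = 2 := by
  rintro ⟨S, hS, hcard, hr⟩
  obtain ⟨n, rfl⟩ : ∃ n, s = n + 1 := ⟨s - 1, by omega⟩
  obtain rfl : N = 2 * n := by omega
  exact rval_ne_two (by omega) hS hcard hr
end

section
/- Let s be a positive integer and N ≥ s + 1. For every integer v with (s−1)(s−2)/2 ≤ v ≤ s(s−1)/2, there exists a subset S ⊆ [1,N] with |S| = s and r(S) = v. -/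
/-- The interval `[1,n]` has `n.choose 2` ordered pairs whose sum stays in the interval. -/
theorem rval_Icc_one (n : ℕ) : rval (Finset.Icc 1 n) = n.choose 2 := by
  have key : ∀ x ∈ Finset.range n,
      (∑ y ∈ Finset.Icc 1 n, if (1 + x) + y ∈ Finset.Icc 1 n then 1 else 0) = n - 1 - x := by
    intro x hx
    rw [← Finset.card_filter]
    have : (Finset.Icc 1 n).filter (fun y => (1 + x) + y ∈ Finset.Icc 1 n)
        = Finset.Icc 1 (n - 1 - x) := by
      ext y
      simp only [Finset.mem_filter, Finset.mem_Icc]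
      omega
    rw [this, Nat.card_Icc, Nat.add_sub_cancel]
  rw [rval, Finset.card_filter, Finset.sum_product, ← Finset.Ico_add_one_right_eq_Icc,
    Finset.sum_Ico_eq_sum_range, Nat.add_sub_cancel, Finset.Ico_add_one_right_eq_Icc,
    Finset.sum_congr rfl key, Finset.sum_range_reflect (fun x => x) n, Finset.sum_range_id,
    Nat.choose_two_right]

/-- Number of ordered pairs lost on removing `d` from `[1,n]`. -/
theorem rval_Icc_one_erase {n d : ℕ} (hd : 1 ≤ d) (hdn : d ≤ n) :
    rval ((Finset.Icc 1 n).erase d) + (2 * n - d - 1)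
      = n.choose 2 + if 2 * d ≤ n then 1 else 0 := by
  set A : Finset (ℕ × ℕ) := {d} ×ˢ Finset.Icc 1 (n - d) with hA
  set B : Finset (ℕ × ℕ) := Finset.Icc 1 (n - d) ×ˢ {d} with hB
  set C : Finset (ℕ × ℕ) := (Finset.Icc 1 (d - 1)).image (fun y => (y, d - y)) with hC
  set R := (((Finset.Icc 1 n).erase d) ×ˢ ((Finset.Icc 1 n).erase d)).filter
    (fun p => p.1 + p.2 ∈ (Finset.Icc 1 n).erase d) with hR
  have memC : ∀ x y, (x, y) ∈ C ↔ 1 ≤ x ∧ 1 ≤ y ∧ x + y = d := by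
    intro x y
    simp only [hC, Finset.mem_image, Finset.mem_Icc, Prod.mk.injEq]
    constructor
    · rintro ⟨z, hz, rfl, rfl⟩
      omega
    · intro h
      exact ⟨x, by omega, rfl, by omega⟩
  have cardA : A.card = n - d := by simp [hA]
  have cardB : B.card = n - d := by simp [hB]
  have cardC : C.card = d - 1 := by
    rw [hC, Finset.card_image_of_injective _ fun a b h => (Prod.mk.inj h).1]
    simp
  have cardAB : (A ∩ B).card = if 2 * d ≤ n then 1 else 0 := by
    split_ifs with h
    · rw [Finset.card_eq_one]
      refine ⟨(d, d), ?_⟩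
      ext ⟨x, y⟩
      simp only [hA, hB, Finset.mem_inter, Finset.mem_product, Finset.mem_singleton,
        Finset.mem_Icc, Prod.mk.injEq]
      omega
    · rw [Finset.card_eq_zero, Finset.eq_empty_iff_forall_notMem]
      rintro ⟨x, y⟩
      simp only [hA, hB, Finset.mem_inter, Finset.mem_product, Finset.mem_singleton,
        Finset.mem_Icc]
      omega
  have disjC : Disjoint (A ∪ B) C := by
    rw [Finset.disjoint_left]
    rintro ⟨x, y⟩
    simp only [memC, hA, hB, Finset.mem_union, Finset.mem_product, Finset.mem_singleton,
      Finset.mem_Icc]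
    omega
  have disjR : Disjoint R ((A ∪ B) ∪ C) := by
    rw [Finset.disjoint_left]
    rintro ⟨x, y⟩
    simp only [memC, hA, hB, hR, Finset.mem_union, Finset.mem_product, Finset.mem_singleton,
      Finset.mem_Icc, Finset.mem_filter, Finset.mem_erase]
    omega
  have full : ((Finset.Icc 1 n) ×ˢ (Finset.Icc 1 n)).filter
      (fun p => p.1 + p.2 ∈ Finset.Icc 1 n) = R ∪ ((A ∪ B) ∪ C) := by
    ext ⟨x, y⟩
    simp only [memC, hA, hB, hR, Finset.mem_union, Finset.mem_product, Finset.mem_singleton,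
      Finset.mem_Icc, Finset.mem_filter, Finset.mem_erase]
    omega
  have hfull := rval_Icc_one n
  rw [rval, full, Finset.card_union_of_disjoint disjR, Finset.card_union_of_disjoint disjC] at hfull
  have hAB := Finset.card_union_add_card_inter A B
  change R.card + _ = _
  omega

/-- Proposition 5.1: for `N ≥ s + 1`, every value in `[(s−1)(s−2)/2, s(s−1)/2]` is
attained as `r(S)` for some `s`-element subset `S ⊆ [1,N]`. -/
theorem spectrum_top_interval (s N : ℕ) (hs : 0 < s) (hN : s + 1 ≤ N) :
    ∀ v : ℕ, (s - 1) * (s - 2) / 2 ≤ v → v ≤ s * (s - 1) / 2 →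
      ∃ S : Finset ℕ, S ⊆ Finset.Icc 1 N ∧ S.card = s ∧ rval S = v := by
  intro v hlo hhi
  obtain ⟨m, rfl⟩ : ∃ m, s = m + 1 := ⟨s - 1, by omega⟩
  rw [← Nat.choose_two_right] at hhi
  rw [show m + 1 - 2 = m - 1 by omega, Nat.add_sub_cancel, ← Nat.choose_two_right] at hlo
  have h₁ : (m + 1).choose 2 = m + m.choose 2 := by simp [Nat.choose_succ_succ' m 1]
  have h₂ : (m + 2).choose 2 = m + 1 + (m + 1).choose 2 := by
    simp [Nat.choose_succ_succ' (m + 1) 1]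
  suffices h : ∃ d, 1 ≤ d ∧ d ≤ m + 2 ∧
      v + (2 * (m + 2) - d - 1) = (m + 2).choose 2 + if 2 * d ≤ m + 2 then 1 else 0 by
    obtain ⟨d, hd, hdn, hv⟩ := h
    refine ⟨(Finset.Icc 1 (m + 2)).erase d, ?_, ?_, ?_⟩
    · exact (Finset.erase_subset _ _).trans (Finset.Icc_subset_Icc_right hN)
    · rw [Finset.card_erase_of_mem (Finset.mem_Icc.2 ⟨hd, hdn⟩)]
      simp
    · have := rval_Icc_one_erase hd hdn
      omega
  by_cases hk : m + 2 < 2 * (m + 2 + v - (m + 1).choose 2)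
  · refine ⟨m + 2 + v - (m + 1).choose 2, by omega, by omega, ?_⟩
    rw [if_neg (by omega)]
    omega
  · refine ⟨m + 1 + v - (m + 1).choose 2, by omega, by omega, ?_⟩
    rw [if_pos (by omega)]
    omega
end

section
/- Let s be a positive integer and 2 ≤ a ≤ s − 1. For every integer v with (s−a)(s−a+1)/2 ≤ v ≤ (s−a+1)(s−a+2)/2 − 1, there exists a subset S ⊆ [1, s+a] with |S| = s and r(S) = v. -/
open Finset in
theorem rval_erase_add_s15 {S : Finset ℕ} (h0 : 0 ∉ S) {q : ℕ} (hq : q ∈ S) :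
    rval (S.erase q) + #{x ∈ S | ∃ y ∈ S, x + y = q} + #{y ∈ S | q + y ∈ S}
      + #{y ∈ S.erase q | q + y ∈ S} = rval S := by
  have pos : ∀ x ∈ S, 0 < x := fun x hx => Nat.pos_of_ne_zero fun h => h0 (h ▸ hx)
  have hqpos := pos q hq
  unfold rval
  set P := (S ×ˢ S).filter (fun p => p.1 + p.2 ∈ S) with hP
  have hsum : #{x ∈ S | ∃ y ∈ S, x + y = q} = #{p ∈ P | p.1 + p.2 = q} := by
    refine card_bij' (fun x _ => (x, q - x)) (fun p _ => p.1) ?_ ?_ ?_ ?_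
    · intro x hx
      obtain ⟨hxS, y, hy, rfl⟩ := mem_filter.1 hx
      simp [hP, hxS, hy, hq]
    · rintro ⟨x, y⟩ hp
      simp only [hP, mem_filter, mem_product] at hp ⊢
      exact ⟨hp.1.1.1, y, hp.1.1.2, hp.2⟩
    · simp
    · rintro ⟨x, y⟩ hp
      simp only [hP, mem_filter, mem_product] at hp
      simp only [Prod.mk.injEq, true_and]
      omega
  have hleft : #{y ∈ S | q + y ∈ S} = #{p ∈ {p ∈ P | ¬ p.1 + p.2 = q} | p.1 = q} := by
    refine card_bij' (fun y _ => (q, y)) (fun p _ => p.2) ?_ ?_ ?_ ?_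
    · intro y hy
      obtain ⟨hy, hqy⟩ := mem_filter.1 hy
      have := pos y hy
      simp only [hP, mem_filter, mem_product]
      exact ⟨⟨⟨⟨hq, hy⟩, hqy⟩, by omega⟩, trivial⟩
    · rintro ⟨x, y⟩ hp
      simp only [hP, mem_filter, mem_product] at hp ⊢
      obtain ⟨⟨⟨⟨_, _⟩, _⟩, _⟩, rfl⟩ := hp
      constructor <;> assumption
    · simp
    · rintro ⟨x, y⟩ hp
      simp only [mem_filter] at hp
      simp [hp.2]
  have hright : #{y ∈ S.erase q | q + y ∈ S} =
      #{p ∈ {p ∈ {p ∈ P | ¬ p.1 + p.2 = q} | ¬ p.1 = q} | p.2 = q} := by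
    refine card_bij' (fun y _ => (y, q)) (fun p _ => p.1) ?_ ?_ ?_ ?_
    · intro y hy
      simp only [mem_filter, mem_erase] at hy
      have := pos y hy.1.2
      simp only [hP, mem_filter, mem_product]
      refine ⟨⟨⟨⟨⟨hy.1.2, hq⟩, ?_⟩, by omega⟩, hy.1.1⟩, trivial⟩
      rw [add_comm]; exact hy.2
    · rintro ⟨x, y⟩ hp
      simp only [hP, mem_filter, mem_product, mem_erase] at hp ⊢
      obtain ⟨⟨⟨⟨⟨h1, h2⟩, h3⟩, h4⟩, h5⟩, rfl⟩ := hp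
      exact ⟨⟨h5, h1⟩, by rw [add_comm]; exact h3⟩
    · simp
    · rintro ⟨x, y⟩ hp
      simp only [mem_filter] at hp
      simp [hp.2]
  have hrest : (S.erase q ×ˢ S.erase q).filter (fun p => p.1 + p.2 ∈ S.erase q) =
      {p ∈ {p ∈ {p ∈ P | ¬ p.1 + p.2 = q} | ¬ p.1 = q} | ¬ p.2 = q} := by
    ext ⟨x, y⟩
    simp only [hP, mem_filter, mem_product, mem_erase]
    tauto
  rw [hrest, hsum, hleft, hright]
  have h1 := card_filter_add_card_filter_not (s := P) (fun p => p.1 + p.2 = q)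
  have h2 := card_filter_add_card_filter_not (s := {p ∈ P | ¬ p.1 + p.2 = q}) (fun p => p.1 = q)
  have h3 := card_filter_add_card_filter_not
    (s := {p ∈ {p ∈ P | ¬ p.1 + p.2 = q} | ¬ p.1 = q}) (fun p => p.2 = q)
  omega

open Finset in
theorem card_filter_exists_add_eq_Icc (c M q : ℕ) (hq : q ≤ M) :
    #{x ∈ Icc c M | ∃ y ∈ Icc c M, x + y = q} = q + 1 - 2 * c := by
  have : {x ∈ Icc c M | ∃ y ∈ Icc c M, x + y = q} = (Icc c M).filter (fun x => x + c ≤ q) := by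
    ext x
    simp only [mem_filter, mem_Icc]
    constructor
    · rintro ⟨h, y, hy, rfl⟩; omega
    · rintro ⟨h, h'⟩; exact ⟨h, q - x, by omega, by omega⟩
  rw [this]
  have : (Icc c M).filter (fun x => x + c ≤ q) = Ico c (q + 1 - c) := by
    ext x; simp only [mem_filter, mem_Icc, mem_Ico]; omega
  rw [this, Nat.card_Ico]
  omega

open Finset in
theorem filter_add_mem_Icc {c M q : ℕ} :
    {y ∈ Icc c M | q + y ∈ Icc c M} = Ico c (M + 1 - q) := by
  ext x; simp only [mem_filter, mem_Icc, mem_Ico]; omega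

open Finset in
theorem rval_Icc_erase_add {c M q : ℕ} (hc : 0 < c) (hq : q ∈ Icc c M) :
    rval ((Icc c M).erase q) + (q + 1 - 2 * c) + 2 * (M + 1 - q - c)
      = rval (Icc c M) + if 2 * q ≤ M then 1 else 0 := by
  have h := rval_erase_add_s15 (S := Icc c M) (by simp; omega) hq
  have hq' := mem_Icc.1 hq
  rw [card_filter_exists_add_eq_Icc c M q hq'.2, filter_erase, filter_add_mem_Icc,
    card_erase_eq_ite, Nat.card_Ico] at h
  simp only [mem_Ico] at h
  split_ifs at h ⊢ <;> omega

open Finset in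
theorem two_mul_rval_Icc_s15 {c : ℕ} (hc : 0 < c) (n : ℕ) :
    2 * rval (Icc c (2 * c + n)) = (n + 1) * (n + 2) := by
  have step : ∀ n, rval (Icc c (2 * c + n)) = rval (Icc c (2 * c + n - 1)) + (n + 1) := by
    intro n
    have h := rval_Icc_erase_add (c := c) (M := 2 * c + n) (q := 2 * c + n) hc
      (by simp only [mem_Icc]; omega)
    have : (Icc c (2 * c + n)).erase (2 * c + n) = Icc c (2 * c + n - 1) := by
      ext x; simp only [mem_erase, mem_Icc]; omega
    rw [this, if_neg (by omega)] at h
    omega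
  induction n with
  | zero =>
    have : rval (Icc c (2 * c + 0 - 1)) = 0 := by
      simp only [rval, card_eq_zero, filter_eq_empty_iff, mem_product, mem_Icc]
      omega
    rw [step, this]
  | succ n ih =>
    have h := step (n + 1)
    rw [show 2 * c + (n + 1) - 1 = 2 * c + n by omega] at h
    rw [h]
    linarith

open Finset in
theorem rval_Icc_erase_erase {c m i : ℕ} (hc : 2 ≤ c) (hi : i < c) (him : 2 * i < m) :
    rval (((Icc c (2 * c + 2 + m)).erase (2 * c + 1 + m)).erase (c + i)) + (3 * m + 5)
      = rval (Icc c (2 * c + 2 + m)) + 2 * i := by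
  have hz := rval_Icc_erase_add (c := c) (M := 2 * c + 2 + m) (q := 2 * c + 1 + m) (by omega)
    (by simp only [mem_Icc]; omega)
  rw [if_neg (by omega)] at hz
  have h := rval_erase_add_s15 (S := (Icc c (2 * c + 2 + m)).erase (2 * c + 1 + m)) (q := c + i)
    (by simp only [mem_erase, mem_Icc]; omega) (by simp only [mem_erase, mem_Icc]; omega)
  have hsum : {x ∈ (Icc c (2 * c + 2 + m)).erase (2 * c + 1 + m) |
      ∃ y ∈ (Icc c (2 * c + 2 + m)).erase (2 * c + 1 + m), x + y = c + i} = ∅ := by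
    simp only [filter_eq_empty_iff, mem_erase, mem_Icc, not_exists, not_and]
    omega
  have hadd : {y ∈ (Icc c (2 * c + 2 + m)).erase (2 * c + 1 + m) |
      c + i + y ∈ (Icc c (2 * c + 2 + m)).erase (2 * c + 1 + m)}
        = (Icc c (c + 2 + m - i)).erase (c + 1 + m - i) := by
    ext y; simp only [mem_filter, mem_erase, mem_Icc]; omega
  rw [hsum, filter_erase _ (c + i), hadd, card_empty,
    card_erase_of_mem (a := c + i) (by simp only [mem_erase, mem_Icc]; omega),
    card_erase_of_mem (by simp only [mem_Icc]; omega), Nat.card_Icc] at h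
  omega

/-- Proposition 5.4: for `2 ≤ a ≤ s − 1`, every value in
`[(s−a)(s−a+1)/2, (s−a+1)(s−a+2)/2 − 1]` is attained as `r(S)` for some
`s`-element subset `S ⊆ [1, s+a]`. -/
theorem spectrum_middle_interval (s a : ℕ) (hs : 0 < s) (ha : 2 ≤ a) (has : a ≤ s - 1) :
    ∀ v : ℕ, (s - a) * (s - a + 1) / 2 ≤ v → v ≤ (s - a + 1) * (s - a + 2) / 2 - 1 →
      ∃ S : Finset ℕ, S ⊆ Finset.Icc 1 (s + a) ∧ S.card = s ∧ rval S = v := by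
  intro v hv1 hv2
  obtain ⟨m, rfl⟩ : ∃ m, s = m + a := ⟨s - a, by omega⟩
  obtain ⟨c, rfl⟩ : ∃ c, a = c + 1 := ⟨a - 1, by omega⟩
  rw [Nat.add_sub_cancel] at hv1 hv2
  obtain ⟨T, hT⟩ : ∃ T, m * (m + 1) = 2 * T := (Nat.even_mul_succ_self m).two_dvd
  have hT1 : (m + 1) * (m + 2) = 2 * (T + m + 1) := by linarith
  have hT2 : rval (Finset.Icc c (2 * c + 1 + m)) = T + 2 * m + 3 := by
    have := two_mul_rval_Icc_s15 (c := c) (by omega) (m + 1)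
    rw [show 2 * c + (m + 1) = 2 * c + 1 + m by omega] at this
    linarith
  have hT3 : rval (Finset.Icc c (2 * c + 2 + m)) = T + 3 * m + 6 := by
    have := two_mul_rval_Icc_s15 (c := c) (by omega) (m + 2)
    rw [show 2 * c + (m + 2) = 2 * c + 2 + m by omega] at this
    linarith
  rw [hT, Nat.mul_div_cancel_left _ two_pos] at hv1
  rw [hT1, Nat.mul_div_cancel_left _ two_pos] at hv2
  obtain ⟨j, rfl⟩ : ∃ j, v = T + j := ⟨v - T, by omega⟩
  have erase_one : ∀ q ∈ Finset.Icc c (2 * c + 1 + m),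
      rval ((Finset.Icc c (2 * c + 1 + m)).erase q) = T + j →
      ∃ S : Finset ℕ, S ⊆ Finset.Icc 1 (m + (c + 1) + (c + 1)) ∧ S.card = m + (c + 1) ∧
        rval S = T + j := by
    intro q hq h
    refine ⟨_, ?_, ?_, h⟩
    · intro x; simp only [Finset.mem_erase, Finset.mem_Icc]; omega
    · rw [Finset.card_erase_of_mem hq, Nat.card_Icc]; omega
  have hr := fun q hq => rval_Icc_erase_add (c := c) (M := 2 * c + 1 + m) (q := q) (by omega) hq
  rw [hT2] at hr
  rcases lt_or_ge j (2 * c - 1) with hj | hj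
  · obtain ⟨i, rfl | rfl⟩ := Nat.even_or_odd' j
    · have hq : c + i ∈ Finset.Icc c (2 * c + 1 + m) := by simp only [Finset.mem_Icc]; omega
      have h := hr _ hq
      rw [if_pos (by omega)] at h
      exact erase_one _ hq (by omega)
    · refine ⟨((Finset.Icc c (2 * c + 2 + m)).erase (2 * c + 1 + m)).erase (c + i), ?_, ?_, ?_⟩
      · intro x; simp only [Finset.mem_erase, Finset.mem_Icc]; omega
      · rw [Finset.card_erase_of_mem (by simp only [Finset.mem_erase, Finset.mem_Icc]; omega),
          Finset.card_erase_of_mem (by simp only [Finset.mem_Icc]; omega), Nat.card_Icc]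
        omega
      · have := rval_Icc_erase_erase (c := c) (m := m) (i := i) (by omega) (by omega) (by omega)
        omega
  · by_cases hq2 : 2 * (j + 1) ≤ 2 * c + 1 + m
    · have hq : j + 1 ∈ Finset.Icc c (2 * c + 1 + m) := by simp only [Finset.mem_Icc]; omega
      have h := hr _ hq
      rw [if_pos hq2] at h
      exact erase_one _ hq (by omega)
    · have hq : j + 2 ∈ Finset.Icc c (2 * c + 1 + m) := by simp only [Finset.mem_Icc]; omega
      have h := hr _ hq
      rw [if_neg (by omega)] at h
      exact erase_one _ hq (by omega)
end

section
/- Let s be a positive integer and N ≥ s + 1. Then R(s,N) contains the whole interval [f_{s,N−1}, g_{s,N−1}]; that is, for every integer v with f_{s,N−1} ≤ v ≤ g_{s,N−1}, there exists S ⊆ [1,N] with |S| = s and r(S) = v. -/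
/-- `R(s,N)`: the set of `r`-values attained by `s`-element subsets of `[1,N]`. -/
def Rset (s N : ℕ) : Set ℕ :=
  {v | ∃ S : Finset ℕ, S ⊆ Finset.Icc 1 N ∧ S.card = s ∧ rval S = v}

open Finset

/-- The `n`-th triangular number `0 + 1 + ⋯ + n`. -/
def triangular (n : ℕ) : ℕ := ∑ i ∈ range (n + 1), i

lemma triangular_zero : triangular 0 = 0 := by simp [triangular]

lemma triangular_succ (n : ℕ) : triangular (n + 1) = triangular n + (n + 1) :=
  sum_range_succ _ _

lemma triangular_mono : Monotone triangular :=
  monotone_nat_of_le_succ fun n => by rw [triangular_succ]; omega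

lemma le_triangular (n : ℕ) : n ≤ triangular n := by
  cases n with
  | zero => simp
  | succ n => rw [triangular_succ]; omega

lemma rval_empty : rval ∅ = 0 := by simp [rval]

lemma rval_insert_of_lt {S : Finset ℕ} {t : ℕ} (ht₀ : 0 < t) (h : ∀ x ∈ S, 0 < x ∧ x < t) :
    rval (insert t S) = rval S + #{x ∈ S | t - x ∈ S} := by
  have hinj : Set.InjOn (fun x : ℕ => (x, t - x)) ({x ∈ S | t - x ∈ S} : Finset ℕ) := by
    intro x _ y _ hxy
    simpa using congrArg Prod.fst hxy
  rw [← card_image_of_injOn hinj, rval, rval, ← card_union_of_disjoint]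
  · congr 1
    ext ⟨x, y⟩
    simp only [mem_filter, mem_product, mem_insert, mem_union, mem_image, Prod.mk.injEq]
    constructor
    · rintro ⟨⟨hx, hy⟩, hxy⟩
      have hx' : x ∈ S → 0 < x ∧ x < t := h x
      have hy' : y ∈ S → 0 < y ∧ y < t := h y
      have hs' : x + y ∈ S → 0 < x + y ∧ x + y < t := h (x + y)
      by_cases hxt : x + y = t
      · have ht : t ∉ S := fun ht => lt_irrefl _ (h t ht).2
        have hty : t - x = y := by omega
        rcases hx with rfl | hx
        · grind
        · rcases hy with rfl | hy
          · grind
          · exact Or.inr ⟨x, ⟨hx, hty ▸ hy⟩, rfl, hty⟩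
      · have hS : x + y ∈ S := by tauto
        have := hs' hS
        refine Or.inl ⟨⟨?_, ?_⟩, hS⟩
        · rcases hx with rfl | hx
          · omega
          · exact hx
        · rcases hy with rfl | hy
          · omega
          · exact hy
    · rintro (⟨⟨hx, hy⟩, hxy⟩ | ⟨z, ⟨hz, htz⟩, rfl, rfl⟩)
      · tauto
      · have := h z hz
        exact ⟨⟨Or.inr hz, Or.inr htz⟩, Or.inl (by omega)⟩
  · rw [disjoint_left]
    rintro ⟨x, y⟩ h₁ h₂
    simp only [mem_filter, mem_product, mem_image, Prod.mk.injEq] at h₁ h₂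
    obtain ⟨z, ⟨hz, _⟩, rfl, rfl⟩ := h₂
    have := h z hz
    have := h _ h₁.2
    omega

lemma rval_le_triangular (S : Finset ℕ) (hS : ∀ x ∈ S, 0 < x) :
    rval S ≤ triangular (#S - 1) := by
  induction S using Finset.induction_on_max with
  | empty => simp [rval_empty]
  | insert t S ht ih =>
    have htS : t ∉ S := fun h => lt_irrefl _ (ht t h)
    have h : ∀ x ∈ S, 0 < x ∧ x < t := fun x hx => ⟨hS x (mem_insert_of_mem hx), ht x hx⟩
    rw [rval_insert_of_lt (hS t (mem_insert_self t S)) h, card_insert_of_notMem htS]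
    have h₁ := ih fun x hx => (h x hx).1
    have h₂ : #{x ∈ S | t - x ∈ S} ≤ #S := card_filter_le _ _
    rcases Nat.eq_zero_or_pos #S with h₀ | h₀
    · rw [h₀] at h₁ h₂ ⊢
      simp only [Nat.zero_sub, triangular_zero] at h₁
      rw [Nat.zero_add, Nat.sub_self, triangular_zero]
      omega
    · obtain ⟨n, hn⟩ := Nat.exists_eq_succ_of_ne_zero h₀.ne'
      rw [hn] at h₁ h₂ ⊢
      simp only [Nat.succ_eq_add_one, Nat.add_sub_cancel] at *
      rw [triangular_succ]
      omega

lemma two_mul_card_le_card_filter_sub_mem {S : Finset ℕ} {t : ℕ} (h : ∀ x ∈ S, 0 < x ∧ x < t) :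
    2 * #S ≤ (t - 1) + #{x ∈ S | t - x ∈ S} := by
  have hinj : Set.InjOn (fun x => t - x) S := by
    intro x hx y hy hxy
    have := h x hx
    have := h y hy
    simp only at hxy
    omega
  have hinter : S ∩ S.image (fun x => t - x) ⊆ {x ∈ S | t - x ∈ S} := by
    intro x hx
    simp only [mem_inter, mem_image, mem_filter] at hx ⊢
    obtain ⟨hx, y, hy, rfl⟩ := hx
    have := h y hy
    rw [Nat.sub_sub_self (by omega)]
    exact ⟨hx, hy⟩
  have hunion : S ∪ S.image (fun x => t - x) ⊆ Ico 1 t := by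
    intro x hx
    simp only [mem_union, mem_image, mem_Ico] at hx ⊢
    rcases hx with hx | ⟨y, hy, rfl⟩
    · have := h x hx
      omega
    · have := h y hy
      omega
  have h₁ := card_le_card hinter
  have h₂ := card_le_card hunion
  have h₃ := card_union_add_card_inter S (S.image fun x => t - x)
  rw [card_image_of_injOn hinj] at h₃
  rw [Nat.card_Ico] at h₂
  omega

lemma triangular_le_rval (S : Finset ℕ) (M : ℕ) (hS : S ⊆ Icc 1 M) :
    triangular (2 * #S - 1 - M) ≤ rval S := by
  induction S using Finset.induction_on_max generalizing M with
  | empty => simp [triangular_zero]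
  | insert t S ht ih =>
    have htS : t ∉ S := fun h => lt_irrefl _ (ht t h)
    have h : ∀ x ∈ S, 0 < x ∧ x < t := fun x hx =>
      ⟨(mem_Icc.1 (hS (mem_insert_of_mem hx))).1, ht x hx⟩
    have htM := mem_Icc.1 (hS (mem_insert_self t S))
    have h₁ := ih (t - 1) fun x hx => mem_Icc.2 (by have := h x hx; omega)
    have h₂ := two_mul_card_le_card_filter_sub_mem h
    rw [rval_insert_of_lt htM.1 h, card_insert_of_notMem htS]
    have h₃ : triangular (2 * (#S + 1) - 1 - M) ≤ triangular (2 * (#S + 1) - 1 - t) :=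
      triangular_mono (by omega)
    refine h₃.trans ?_
    rcases le_or_gt (2 * #S + 1) t with h₄ | h₄
    · rw [show 2 * (#S + 1) - 1 - t = 0 by omega, triangular_zero]
      exact Nat.zero_le _
    · rw [show 2 * (#S + 1) - 1 - t = (2 * #S - 1 - (t - 1)) + 1 by omega, triangular_succ]
      omega

lemma rval_Icc_s16 {b : ℕ} (hb : 0 < b) (k : ℕ) : rval (Icc b (2 * b - 1 + k)) = triangular k := by
  induction k with
  | zero =>
    rw [triangular_zero, rval, card_eq_zero, filter_eq_empty_iff]
    rintro ⟨x, y⟩ h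
    simp only [mem_product, mem_Icc] at h ⊢
    omega
  | succ k ih =>
    have hI : Icc b (2 * b - 1 + (k + 1)) = insert (2 * b - 1 + (k + 1)) (Icc b (2 * b - 1 + k)) := by
      ext x
      simp only [mem_Icc, mem_insert]
      omega
    have hF : {x ∈ Icc b (2 * b - 1 + k) | 2 * b - 1 + (k + 1) - x ∈ Icc b (2 * b - 1 + k)} =
        Icc b (b + k) := by
      ext x
      simp only [mem_filter, mem_Icc]
      omega
    rw [hI, rval_insert_of_lt (by omega), ih, hF, triangular_succ, Nat.card_Icc]
    · omega
    · intro x hx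
      rw [mem_Icc] at hx
      omega

lemma rval_Icc_erase {b : ℕ} (hb : 0 < b) (k x : ℕ) (hx : x ≤ b + k) :
    rval ((Icc b (2 * b + k)).erase (b + x)) + (x + 1 - b) + 2 * (k + 1 - x) =
      triangular (k + 1) + if 2 * x ≤ k then 1 else 0 := by
  have hT := rval_Icc_s16 hb (k + 1)
  rw [show 2 * b - 1 + (k + 1) = 2 * b + k by omega] at hT
  rw [← hT]
  set A := Icc b (2 * b + k) with hA
  set P := (Icc b x).image fun y => (y, b + x - y) with hP
  set Q := (Icc b (b + k - x)).image fun y => (b + x, y) with hQ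
  set Q' := ((Icc b (b + k - x)).erase (b + x)).image fun y => (y, b + x) with hQ'
  have cP : #P = x + 1 - b := by
    rw [hP, card_image_of_injective, Nat.card_Icc]
    intro y z hyz
    simpa using congrArg Prod.fst hyz
  have cQ : #Q = b + k - x + 1 - b := by
    rw [hQ, card_image_of_injective, Nat.card_Icc]
    intro y z hyz
    simpa using congrArg Prod.snd hyz
  have cQ' : #Q' + (if 2 * x ≤ k then 1 else 0) = b + k - x + 1 - b := by
    rw [hQ', card_image_of_injective _ fun y z hyz => by simpa using congrArg Prod.fst hyz,
      card_erase_eq_ite, Nat.card_Icc]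
    simp only [mem_Icc]
    split_ifs <;> omega
  have hU : {p ∈ A ×ˢ A | p.1 + p.2 ∈ A} =
      (({p ∈ A.erase (b + x) ×ˢ A.erase (b + x) | p.1 + p.2 ∈ A.erase (b + x)} ∪ P) ∪ Q) ∪ Q' := by
    ext ⟨y, z⟩
    simp only [hA, hP, hQ, hQ', mem_filter, mem_product, mem_union, mem_image, mem_erase, mem_Icc,
      Prod.mk.injEq]
    constructor
    · intro h
      by_cases h₁ : y = b + x
      · exact Or.inl (Or.inr ⟨z, by omega, by omega, rfl⟩)
      by_cases h₂ : z = b + x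
      · exact Or.inr ⟨y, by omega, rfl, by omega⟩
      by_cases h₃ : y + z = b + x
      · exact Or.inl (Or.inl (Or.inr ⟨y, by omega, rfl, by omega⟩))
      · exact Or.inl (Or.inl (Or.inl (by omega)))
    · rintro (((h | ⟨w, h⟩) | ⟨w, h⟩) | ⟨w, h⟩) <;> omega
  have hcard := congrArg card hU
  rw [card_union_of_disjoint, card_union_of_disjoint, card_union_of_disjoint] at hcard
  · unfold rval
    split_ifs at cQ' ⊢ <;> omega
  all_goals
    rw [disjoint_left]
    rintro ⟨y, z⟩
    simp only [hA, hP, hQ, hQ', mem_filter, mem_product, mem_union, mem_image, mem_erase, mem_Icc,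
      Prod.mk.injEq]
  · rintro h ⟨w, h'⟩
    omega
  · rintro (h | ⟨v, h⟩) ⟨w, h'⟩ <;> omega
  · rintro ((h | ⟨v, h⟩) | ⟨v, h⟩) ⟨w, h'⟩ <;> omega

lemma rval_insert_Icc_erase {b : ℕ} (hb : 2 ≤ b) (m x : ℕ) (hxm : 2 * x ≤ m) (hxb : x < b) :
    rval (insert (2 * b + m + 2) ((Icc b (2 * b + m)).erase (b + x))) =
      triangular m + (2 * x + 1) := by
  have hlt : ∀ y ∈ (Icc b (2 * b + m)).erase (b + x), 0 < y ∧ y < 2 * b + m + 2 := by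
    intro y hy
    simp only [mem_erase, mem_Icc] at hy
    omega
  have hF : {y ∈ (Icc b (2 * b + m)).erase (b + x) |
      2 * b + m + 2 - y ∈ (Icc b (2 * b + m)).erase (b + x)} =
        ((Icc b (b + m + 2)).erase (b + x)).erase (b + m + 2 - x) := by
    ext y
    simp only [mem_filter, mem_erase, mem_Icc]
    omega
  have hr := rval_Icc_erase (b := b) (by omega) m x (by omega)
  rw [if_pos hxm, triangular_succ] at hr
  rw [rval_insert_of_lt (by omega) hlt, hF, card_erase_of_mem, card_erase_of_mem, Nat.card_Icc]
  · omega
  · rw [mem_Icc]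
    omega
  · simp only [mem_erase, mem_Icc]
    omega

lemma exists_rval_eq_triangular_add {b : ℕ} (hb : 0 < b) {m j : ℕ} (hj : j ≤ m) :
    ∃ S ⊆ Icc 1 (2 * b + m + 2), #S = b + m + 1 ∧ rval S = triangular m + j := by
  have of_erase : ∀ x ≤ b + m + 1,
      rval ((Icc b (2 * b + (m + 1))).erase (b + x)) = triangular m + j →
        ∃ S ⊆ Icc 1 (2 * b + m + 2), #S = b + m + 1 ∧ rval S = triangular m + j := by
    refine fun x hx h => ⟨_, fun y hy => ?_, ?_, h⟩
    · simp only [mem_erase, mem_Icc] at hy ⊢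
      omega
    · rw [card_erase_of_mem (by rw [mem_Icc]; omega), Nat.card_Icc]
      omega
  have hr := fun x hx => rval_Icc_erase hb (m + 1) x hx
  simp only [triangular_succ] at hr
  rcases lt_or_ge j (2 * b - 1) with h₁ | h₁
  · obtain ⟨x, rfl | rfl⟩ := Nat.even_or_odd' j
    · have := hr x (by omega)
      rw [if_pos (by omega)] at this
      exact of_erase x (by omega) (by omega)
    · refine ⟨_, fun y hy => ?_, ?_, rval_insert_Icc_erase (b := b) (by omega) m x (by omega) (by omega)⟩
      · simp only [mem_insert, mem_erase, mem_Icc] at hy ⊢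
        omega
      · rw [card_insert_of_notMem, card_erase_of_mem, Nat.card_Icc]
        · omega
        · rw [mem_Icc]
          omega
        · simp only [mem_erase, mem_Icc]
          omega
  · rcases le_or_gt (2 * (j + 1 - b)) (m + 1) with h₂ | h₂
    · have := hr (j + 1 - b) (by omega)
      rw [if_pos h₂] at this
      exact of_erase (j + 1 - b) (by omega) (by omega)
    · have := hr (j + 2 - b) (by omega)
      rw [if_neg (by omega)] at this
      exact of_erase (j + 2 - b) (by omega) (by omega)

lemma exists_triangular_le_lt (v : ℕ) : ∃ m, triangular m ≤ v ∧ v < triangular (m + 1) := by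
  have h : ∃ n, v < triangular n := ⟨v + 1, le_triangular (v + 1)⟩
  classical
  obtain ⟨m, hm⟩ : ∃ m, Nat.find h = m + 1 := by
    refine Nat.exists_eq_succ_of_ne_zero fun h₀ => ?_
    have := Nat.find_spec h
    rw [h₀, triangular_zero] at this
    omega
  exact ⟨m, not_lt.1 (Nat.find_min h (by omega)), hm ▸ Nat.find_spec h⟩

lemma exists_rval_eq {s N v : ℕ} (hs : 0 < s) (hN : s ≤ N) (h₁ : triangular (2 * s - N) ≤ v)
    (h₂ : v ≤ triangular (s - 1)) : ∃ S ⊆ Icc 1 N, #S = s ∧ rval S = v := by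
  rcases h₂.eq_or_lt with rfl | h₂
  · refine ⟨Icc 1 s, Icc_subset_Icc_right hN, by simp, ?_⟩
    rw [← rval_Icc_s16 one_pos (s - 1)]
    congr 2
    omega
  · obtain ⟨m, hm₁, hm₂⟩ := exists_triangular_le_lt v
    have hms : m < s - 1 := triangular_mono.reflect_lt (hm₁.trans_lt h₂)
    have hmN : 2 * s - N < m + 1 := triangular_mono.reflect_lt (h₁.trans_lt hm₂)
    rw [triangular_succ] at hm₂
    obtain ⟨S, hS, hc, hr⟩ := exists_rval_eq_triangular_add (b := s - 1 - m) (by omega)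
      (m := m) (j := v - triangular m) (by omega)
    exact ⟨S, hS.trans (Icc_subset_Icc_right (by omega)), by omega, by omega⟩

/-- Theorem 5.5: for `N ≥ s + 1`, `R(s,N)` contains the whole integer interval
`[f_{s,N−1}, g_{s,N−1}]`, where `f` and `g` are the min and max of `R(s,N−1)`. -/
theorem spectrum_contains_previous (s N : ℕ) (hs : 0 < s) (hN : s + 1 ≤ N) :
    ∀ v : ℕ, sInf (Rset s (N - 1)) ≤ v → v ≤ sSup (Rset s (N - 1)) →
      ∃ S : Finset ℕ, S ⊆ Finset.Icc 1 N ∧ S.card = s ∧ rval S = v := by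
  intro v hv₁ hv₂
  have hne : (Rset s (N - 1)).Nonempty :=
    ⟨_, Icc 1 s, Icc_subset_Icc_right (by omega), by simp, rfl⟩
  have hle : ∀ w ∈ Rset s (N - 1), w ≤ triangular (s - 1) := by
    rintro _ ⟨S, hS, rfl, rfl⟩
    exact rval_le_triangular S fun x hx => (mem_Icc.1 (hS hx)).1
  obtain ⟨S, hS, hc, hr⟩ := Nat.sInf_mem hne
  refine exists_rval_eq hs (by omega) ?_ (hv₂.trans (csSup_le hne hle))
  have := triangular_le_rval S (N - 1) hS
  rw [hc, hr, show 2 * s - 1 - (N - 1) = 2 * s - N by omega] at this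
  exact this.trans hv₁
end

section
/- Let s be a positive integer and s + 2 ≤ N ≤ 2s − 2. Then there is no subset S ⊆ [1,N] with |S| = s and r(S) = f_{s,N} + 1, where f_{s,N} = (2s−N)(2s−N−1)/2 is the minimum of r over s-element subsets of [1,N]. -/
open Finset

/-- The number of representations of `z` as an ordered sum of two positive elements of `S`. -/
def repCount (S : Finset ℕ) (z : ℕ) : ℕ := #{x ∈ Ico 1 z | x ∈ S ∧ z - x ∈ S}

/-- The number of representations of `z` as an ordered sum of two positive integers outside `S`. -/
def coRepCount (S : Finset ℕ) (z : ℕ) : ℕ := #{x ∈ Ico 1 z | x ∉ S ∧ z - x ∉ S}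

/-- The number of elements of `S` below `z`. -/
def rankBelow (S : Finset ℕ) (z : ℕ) : ℕ := #{x ∈ S | x < z}

/-- The number of positive integers below `z` that are not in `S`. -/
def gapsBelow (S : Finset ℕ) (z : ℕ) : ℕ := #{x ∈ Ico 1 z | x ∉ S}

theorem rval_eq_sum_repCount {S : Finset ℕ} (hS : ∀ x ∈ S, 1 ≤ x) :
    rval S = ∑ z ∈ S, repCount S z := by
  unfold rval repCount
  rw [card_eq_sum_card_fiberwise (f := fun p : ℕ × ℕ => p.1 + p.2) (t := S)]
  · refine sum_congr rfl fun z hz => ?_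
    refine card_bij' (fun p _ => p.1) (fun x _ => (x, z - x)) ?_ ?_ ?_ ?_
    · rintro ⟨x, y⟩ h
      simp only [mem_filter, mem_product, mem_Ico] at h ⊢
      have := hS x h.1.1.1
      have := hS y h.1.1.2
      obtain rfl : z - x = y := by omega
      exact ⟨by omega, h.1.1⟩
    · intro x h
      simp only [mem_filter, mem_product, mem_Ico] at h ⊢
      rw [show x + (z - x) = z by omega]
      exact ⟨⟨h.2, hz⟩, rfl⟩
    · rintro ⟨x, y⟩ h
      simp only [mem_filter] at h
      ext <;> simp
      omega
    · intros; rfl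
  · intro p hp
    simp only [coe_filter, Set.mem_ofPred_eq] at hp
    exact hp.2

theorem rankBelow_add_gapsBelow {S : Finset ℕ} (hS : ∀ x ∈ S, 1 ≤ x) (z : ℕ) :
    rankBelow S z + gapsBelow S z = z - 1 := by
  have h : ({x ∈ S | x < z} : Finset ℕ) = {x ∈ Ico 1 z | x ∈ S} := by
    ext x
    simp only [mem_filter, mem_Ico]
    have := hS x
    tauto
  rw [rankBelow, gapsBelow, h, card_filter_add_card_filter_not, Nat.card_Ico]

theorem repCount_add_gapsBelow {S : Finset ℕ} (hS : ∀ x ∈ S, 1 ≤ x) (z : ℕ) :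
    repCount S z + gapsBelow S z = rankBelow S z + coRepCount S z := by
  have hreflect : #{x ∈ Ico 1 z | z - x ∉ S} = gapsBelow S z := by
    refine card_bij' (fun x _ => z - x) (fun x _ => z - x) ?_ ?_ ?_ ?_ <;> intro x h <;>
      simp only [mem_filter, mem_Ico] at h ⊢
    · exact ⟨by omega, h.2⟩
    · rw [show z - (z - x) = x by omega]
      exact ⟨by omega, h.2⟩
    · omega
    · omega
  have hco : coRepCount S z =
      #(({x ∈ Ico 1 z | x ∉ S} : Finset ℕ) ∩ {x ∈ Ico 1 z | z - x ∉ S}) := by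
    rw [coRepCount, filter_and]
  have hrep : repCount S z + #(({x ∈ Ico 1 z | x ∉ S} : Finset ℕ) ∪ {x ∈ Ico 1 z | z - x ∉ S}) =
      z - 1 := by
    rw [repCount, ← filter_or, ← Nat.card_Ico 1 z,
      ← card_filter_add_card_filter_not (s := Ico 1 z) (fun x => x ∈ S ∧ z - x ∈ S)]
    simp only [not_and_or]
  have hunion := card_union_add_card_inter ({x ∈ Ico 1 z | x ∉ S} : Finset ℕ)
    {x ∈ Ico 1 z | z - x ∉ S}
  rw [hreflect, ← hco] at hunion
  have hgaps : #{x ∈ Ico 1 z | x ∉ S} = gapsBelow S z := rfl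
  have := rankBelow_add_gapsBelow hS z
  omega

theorem rankBelow_lt_rankBelow {S : Finset ℕ} {x y : ℕ} (hx : x ∈ S) (h : x < y) :
    rankBelow S x < rankBelow S y := by
  refine card_lt_card (ssubset_iff.2 ⟨x, by simp, fun a ha => ?_⟩)
  simp only [mem_insert, mem_filter] at ha ⊢
  rcases ha with rfl | ha
  · exact ⟨hx, h⟩
  · exact ⟨ha.1, by omega⟩

theorem rankBelow_injOn (S : Finset ℕ) : Set.InjOn (rankBelow S) S := by
  intro x hx y hy h
  rcases lt_trichotomy x y with hlt | heq | hlt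
  · exact absurd h (rankBelow_lt_rankBelow hx hlt).ne
  · exact heq
  · exact absurd h (rankBelow_lt_rankBelow hy hlt).ne'

theorem image_rankBelow (S : Finset ℕ) : S.image (rankBelow S) = range #S := by
  refine eq_of_subset_of_card_le (fun i hi => ?_) ?_
  · obtain ⟨x, hx, rfl⟩ := mem_image.1 hi
    refine mem_range.2 (card_lt_card (filter_ssubset.2 ⟨x, hx, by simp⟩))
  · rw [card_image_of_injOn (rankBelow_injOn S), card_range]

theorem sum_rankBelow (S : Finset ℕ) (g : ℕ → ℕ) :
    ∑ z ∈ S, g (rankBelow S z) = ∑ i ∈ range #S, g i := by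
  rw [← image_rankBelow, sum_image (rankBelow_injOn S)]

theorem exists_rankBelow_eq {S : Finset ℕ} {i : ℕ} (hi : i < #S) : ∃ z ∈ S, rankBelow S z = i := by
  have h := mem_range.2 hi
  rwa [← image_rankBelow, mem_image] at h

theorem sum_range_tsub (m k : ℕ) : ∑ i ∈ range (m + k), (i - m) = k * (k - 1) / 2 := by
  rw [sum_range_add, sum_eq_zero fun i hi => ?_, zero_add, ← sum_range_id]
  · exact sum_congr rfl fun i _ => by omega
  · have := mem_range.1 hi
    omega

theorem repCount_pos {S : Finset ℕ} {x y : ℕ} (hS : ∀ x ∈ S, 1 ≤ x) (hx : x ∈ S) (hy : y ∈ S) :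
    0 < repCount S (x + y) := by
  have := hS x hx
  have := hS y hy
  exact card_pos.2 ⟨x, by simp [hx, hy]; omega⟩

theorem mem_or_mem_of_coRepCount_eq_zero {S : Finset ℕ} {z x : ℕ} (h : coRepCount S z = 0)
    (h1 : 1 ≤ x) (h2 : x < z) : x ∈ S ∨ z - x ∈ S := by
  have := filter_eq_empty_iff.1 (card_eq_zero.1 h) (mem_Ico.2 ⟨h1, h2⟩)
  tauto

theorem not_mem_of_repCount_eq_zero {S : Finset ℕ} {z x : ℕ} (h : repCount S z = 0)
    (h1 : 1 ≤ x) (h2 : x < z) (hx : x ∈ S) : z - x ∉ S := by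
  have := filter_eq_empty_iff.1 (card_eq_zero.1 h) (mem_Ico.2 ⟨h1, h2⟩)
  tauto

theorem eq_of_repCount_le_one {S : Finset ℕ} {z x y : ℕ} (h : repCount S z ≤ 1)
    (hx : 1 ≤ x ∧ x < z) (hy : 1 ≤ y ∧ y < z) (hxS : x ∈ S ∧ z - x ∈ S) (hyS : y ∈ S ∧ z - y ∈ S) :
    x = y :=
  card_le_one.1 h x (mem_filter.2 ⟨mem_Ico.2 hx, hxS⟩) y (mem_filter.2 ⟨mem_Ico.2 hy, hyS⟩)

theorem eq_of_coRepCount_le_one {S : Finset ℕ} {z x y : ℕ} (h : coRepCount S z ≤ 1)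
    (hx : 1 ≤ x ∧ x < z) (hy : 1 ≤ y ∧ y < z) (hxS : x ∉ S ∧ z - x ∉ S) (hyS : y ∉ S ∧ z - y ∉ S) :
    x = y :=
  card_le_one.1 h x (mem_filter.2 ⟨mem_Ico.2 hx, hxS⟩) y (mem_filter.2 ⟨mem_Ico.2 hy, hyS⟩)

theorem coRepCount_eq_zero_of_le_one {S : Finset ℕ} {z : ℕ} (h : coRepCount S z ≤ 1)
    (hz : ∀ x ∉ S, z ≠ 2 * x) : coRepCount S z = 0 := by
  refine card_eq_zero.2 (filter_eq_empty_iff.2 fun x hx hxS => ?_)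
  rw [mem_Ico] at hx
  have heq := eq_of_coRepCount_le_one h hx (y := z - x) (by omega) hxS
    ⟨hxS.2, by rw [show z - (z - x) = x by omega]; exact hxS.1⟩
  exact hz x hxS.1 (by omega)

theorem gapsBelow_mono (S : Finset ℕ) : Monotone (gapsBelow S) := fun _ _ h =>
  card_le_card (filter_subset_filter _ (Ico_subset_Ico_right h))

theorem card_gaps {S : Finset ℕ} {N : ℕ} (hS : S ⊆ Icc 1 N) : #(Icc 1 N \ S) = N - #S := by
  rw [card_sdiff_of_subset hS, Nat.card_Icc, Nat.add_sub_cancel]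

theorem gaps_below_subset {S : Finset ℕ} {N z : ℕ} (hz : z ≤ N) :
    ({x ∈ Ico 1 z | x ∉ S} : Finset ℕ) ⊆ Icc 1 N \ S := by
  intro x hx
  simp only [mem_filter, mem_Ico, mem_sdiff, mem_Icc] at hx ⊢
  exact ⟨by omega, hx.2⟩

theorem gapsBelow_le {S : Finset ℕ} {N z : ℕ} (hS : S ⊆ Icc 1 N) (hz : z ≤ N) :
    gapsBelow S z ≤ N - #S :=
  card_gaps hS ▸ card_le_card (gaps_below_subset hz)

theorem mem_of_gapsBelow_eq {S : Finset ℕ} {N z x : ℕ} (hS : S ⊆ Icc 1 N) (hz : z ≤ N)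
    (h : gapsBelow S z = N - #S) (h1 : 1 ≤ x) (hzx : z ≤ x) (hx : x ≤ N) : x ∈ S := by
  by_contra hxS
  have heq := eq_of_subset_of_card_le (gaps_below_subset (S := S) hz)
    ((card_gaps hS).trans h.symm).le
  have hmem : x ∈ Icc 1 N \ S := by simp [hxS, h1, hx]
  rw [← heq, mem_filter, mem_Ico] at hmem
  omega

/-- Theorem 5.6: for `s + 2 ≤ N ≤ 2s − 2`, no `s`-element subset of `[1,N]` has
`r`-value `f_{s,N} + 1`, where `f_{s,N} = (2s−N)(2s−N−1)/2`. -/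
theorem no_min_plus_one (s N : ℕ) (hs : 0 < s) (h1 : s + 2 ≤ N) (h2 : N ≤ 2 * s - 2) :
    ¬ ∃ S : Finset ℕ, S ⊆ Finset.Icc 1 N ∧ S.card = s ∧
      rval S = (2 * s - N) * (2 * s - N - 1) / 2 + 1 := by
  rintro ⟨S, hSN, hcard, hr⟩
  obtain ⟨m, hm⟩ : ∃ m, m = N - s := ⟨_, rfl⟩
  have hpos : ∀ x ∈ S, 1 ≤ x := fun x hx => (mem_Icc.1 (hSN hx)).1
  have hle : ∀ x ∈ S, x ≤ N := fun x hx => (mem_Icc.1 (hSN hx)).2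
  have hrank := rankBelow_add_gapsBelow hpos
  have hrep := repCount_add_gapsBelow hpos
  have hgap : ∀ z ∈ S, gapsBelow S z ≤ m := fun z hz => by
    have := gapsBelow_le hSN (hle z hz)
    rwa [hcard, ← hm] at this
  obtain ⟨e, he⟩ : ∃ e : ℕ → ℕ, ∀ z, e z = repCount S z - (rankBelow S z - m) := ⟨_, fun _ => rfl⟩
  have hce : ∀ z ∈ S, repCount S z = (rankBelow S z - m) + e z := fun z hz => by
    have := hgap z hz
    have := hrep z
    have := he z
    omega
  have hsum : ∑ z ∈ S, e z = 1 := by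
    have h := rval_eq_sum_repCount hpos
    rw [sum_congr rfl hce, sum_add_distrib, sum_rankBelow S (· - m), hcard,
      show s = m + (2 * s - N) by omega, sum_range_tsub, hr] at h
    omega
  have hzero : ∀ z ∈ S, e z ≠ 0 → ∀ w ∈ S, w ≠ z → e w = 0 := by
    intro z hz hez w hw hwz
    have h := sum_le_sum_of_subset (f := e) (show ({w, z} : Finset ℕ) ⊆ S by
      intro x hx
      simp only [mem_insert, mem_singleton] at hx
      rcases hx with rfl | rfl <;> assumption)
    rw [sum_pair hwz, hsum] at h
    omega
  have hone : ∀ z ∈ S, e z ≤ 1 := fun z hz => hsum ▸ single_le_sum (fun _ _ => Nat.zero_le _) hz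
  obtain ⟨u, hu, hur⟩ := exists_rankBelow_eq (S := S) (i := m) (by omega)
  obtain ⟨v, hv, hvr⟩ := exists_rankBelow_eq (S := S) (i := m + 1) (by omega)
  have huv : u < v := by
    by_contra h
    have huv : v ≠ u := by rintro rfl; omega
    have := rankBelow_lt_rankBelow hv (y := u) (by omega)
    omega
  have hmono := gapsBelow_mono S huv.le
  have hvg : gapsBelow S v = m := by
    have := fun h => hzero u hu h v hv huv.ne'
    have := hce u hu
    have := hce v hv
    have := hrep u
    have := hrep v
    have := hgap v hv
    omega
  have hv2 : v = 2 * m + 2 := by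
    have := hrank v
    omega
  have hu2 : u = m + gapsBelow S u + 1 := by
    have := hrank u
    have := hpos u hu
    omega
  subst hv2
  have hmem : ∀ x, 2 * m + 2 ≤ x → x ≤ N → x ∈ S := fun x hx hxN =>
    mem_of_gapsBelow_eq hSN (hle _ hv) (by rw [hvg, hcard, hm]) (by omega) hx hxN
  have hcu := hce u hu
  have hcv := hce _ hv
  have hru := hrep u
  have hrv := hrep (2 * m + 2)
  have hlow : ∀ z ∈ S, z < u → repCount S z = e z := fun z hz hzu => by
    have := rankBelow_lt_rankBelow hz hzu
    have := hce z hz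
    omega
  have hu1 := hone u hu
  have hv1 := hone _ hv
  have hgu := hgap u hu
  rcases Nat.lt_or_ge (gapsBelow S u) m with hg | hg
  · obtain rfl : u = 2 * m := by omega
    have hv0 : e (2 * m + 2) = 0 := hzero _ hu (by omega) _ hv (by omega)
    have hmid : 2 * m + 1 ∉ S := fun h => by
      have := rankBelow_lt_rankBelow hu (y := 2 * m + 1) (by omega)
      have := rankBelow_lt_rankBelow h (y := 2 * m + 2) (by omega)
      omega
    have hmS : m ∈ S := by
      have := mem_or_mem_of_coRepCount_eq_zero (S := S) (z := 2 * m) (x := m)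
        (by omega) (by omega) (by omega)
      rwa [show 2 * m - m = m by omega, or_self] at this
    have hvn : coRepCount S (2 * m + 2) = 0 := by omega
    have hm1S : m + 1 ∈ S := by
      have := mem_or_mem_of_coRepCount_eq_zero hvn (x := m + 1) (by omega) (by omega)
      rwa [show 2 * m + 2 - (m + 1) = m + 1 by omega, or_self] at this
    have h1S : 1 ∈ S :=
      (mem_or_mem_of_coRepCount_eq_zero hvn le_rfl (by omega)).resolve_right hmid
    have := repCount_pos hpos hmS h1S
    have := hlow _ hm1S (by omega)
    have := hzero _ hu (by omega) _ hm1S (by omega)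
    omega
  · obtain rfl : u = 2 * m + 1 := by omega
    have hun : coRepCount S (2 * m + 1) = 0 :=
      coRepCount_eq_zero_of_le_one (by omega) fun x _ => by omega
    have huc : repCount S (2 * m + 1) = 0 := by omega
    by_cases hm1S : m + 1 ∈ S
    · have hvn : coRepCount S (2 * m + 2) = 0 :=
        coRepCount_eq_zero_of_le_one (by omega) fun x hx h => hx (by
          rwa [show x = m + 1 by omega])
      have hvc : repCount S (2 * m + 2) ≤ 1 := by omega
      have hpair : ∀ x ∈ S, 1 ≤ x → x ≤ m → 2 * m + 2 - x ∉ S := fun x hx hx1 hxm hxS => by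
        have := eq_of_repCount_le_one hvc (x := x) (y := m + 1) (by omega) (by omega) ⟨hx, hxS⟩
          ⟨hm1S, by rwa [show 2 * m + 2 - (m + 1) = m + 1 by omega]⟩
        omega
      have hlowS : ∀ x, 1 ≤ x → x ≤ m → x ∉ S := by
        intro x hx
        induction x, hx using Nat.le_induction with
        | base => exact fun h h' => hpair 1 h' le_rfl h hu
        | succ x hx ih =>
          intro h h'
          refine hpair _ h' (by omega) h ?_
          rw [show 2 * m + 2 - (x + 1) = 2 * m + 1 - x by omega]
          exact (mem_or_mem_of_coRepCount_eq_zero hun hx (by omega)).resolve_left (ih (by omega))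
      have hhigh : ∀ x, m < x → x ≤ N → x ∈ S := by
        intro x hx hxN
        rcases Nat.lt_or_ge x (2 * m + 1) with h | h
        · exact (mem_or_mem_of_coRepCount_eq_zero hun (by omega) h).resolve_right
            (hlowS _ (by omega) (by omega))
        · rcases h.eq_or_lt with rfl | h
          · exact hu
          · exact hmem x h hxN
      have hall : ∀ z ∈ S, e z = 0 := by
        intro z hz
        have hzN := hle z hz
        rcases Nat.lt_or_ge z (2 * m + 1) with h | h
        · rw [← hlow z hz h]
          refine card_eq_zero.2 (filter_eq_empty_iff.2 fun x hx hxS => ?_)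
          rw [mem_Ico] at hx
          have := hlowS x (by omega)
          have := hlowS (z - x) (by omega)
          have : ¬ x ≤ m := by tauto
          have : ¬ z - x ≤ m := by tauto
          omega
        · have hn : coRepCount S z = 0 := by
            refine card_eq_zero.2 (filter_eq_empty_iff.2 fun x hx hxS => ?_)
            rw [mem_Ico] at hx
            have : ¬ m < x := fun h => hxS.1 (hhigh x h (by omega))
            exact hxS.2 (hhigh _ (by omega) (by omega))
          have := gapsBelow_mono S h
          have := hgap z hz
          have := hrep z
          have := he z
          omega
      rw [sum_eq_zero hall] at hsum
      omega
    · have hvn : coRepCount S (2 * m + 2) ≠ 0 := fun h => by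
        have := mem_or_mem_of_coRepCount_eq_zero h (x := m + 1) (by omega) (by omega)
        rw [show 2 * m + 2 - (m + 1) = m + 1 by omega, or_self] at this
        exact hm1S this
      have hnot : ∀ x ∈ S, ∀ y ∈ S, x + y ≤ 2 * m → x + y ∉ S := fun x hx y hy hxy hS => by
        have := repCount_pos hpos hx hy
        have := hlow _ hS (by omega)
        have := hzero _ hv (by omega) _ hS (by omega)
        omega
      have hmS : m ∈ S := by
        have := mem_or_mem_of_coRepCount_eq_zero hun (x := m) (by omega) (by omega)
        rw [show 2 * m + 1 - m = m + 1 by omega] at this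
        exact this.resolve_right hm1S
      have h2mS : 2 * m ∉ S := by
        have := hnot m hmS m hmS (by omega)
        rwa [← two_mul] at this
      have h1S : 1 ∈ S :=
        (mem_or_mem_of_coRepCount_eq_zero hun le_rfl (by omega)).resolve_right h2mS
      have h2S : 2 ∉ S := hnot 1 h1S 1 h1S (by omega)
      have := eq_of_coRepCount_le_one (S := S) (z := 2 * m + 2) (x := 2) (y := m + 1) (by omega)
        (by omega) (by omega) ⟨h2S, h2mS⟩
        ⟨hm1S, by rwa [show 2 * m + 2 - (m + 1) = m + 1 by omega]⟩
      omega
end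

section
/- Let s be a positive integer and s + 2 ≤ N ≤ 2s − 2. If v is an integer with f_{s,N} ≤ v ≤ g_{s,N} such that no s-element subset S of [1,N] has r(S) = v, then v = f_{s,N} + (2i − 1) for some integer i with 1 ≤ i ≤ min(s − ⌈N/2⌉, ⌊(N−s)/2⌋). -/
open Finset in
/-- Effect on `rval` of deleting an element: one loses the pairs summing to `x` and the pairs
having `x` as a summand. -/
theorem rval_erase {T : Finset ℕ} (h0 : 0 ∉ T) {x : ℕ} (hx : x ∈ T) :
    rval T + (if 2 * x ∈ T then 1 else 0) =
      rval (T.erase x) + #{a ∈ T | a ≤ x ∧ x - a ∈ T} + 2 * #{a ∈ T | x + a ∈ T} := by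
  have hpos : ∀ a ∈ T, 0 < a := fun a ha => Nat.pos_of_ne_zero fun h => h0 (h ▸ ha)
  have hsum : #{p ∈ T ×ˢ T | p.1 + p.2 = x} = #{a ∈ T | a ≤ x ∧ x - a ∈ T} := by
    refine card_bij' (fun p _ => p.1) (fun a _ => (a, x - a)) ?_ ?_ ?_ ?_
    · rintro ⟨a, b⟩ h
      simp only [mem_filter, mem_product] at h ⊢
      obtain ⟨⟨ha, hb⟩, rfl⟩ := h
      simpa [ha] using hb
    · intro a h
      simp only [mem_filter, mem_product] at h ⊢
      exact ⟨⟨h.1, h.2.2⟩, by omega⟩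
    · rintro ⟨a, b⟩ h
      simp only [mem_filter] at h
      exact Prod.ext rfl (by dsimp only; omega)
    · intro a _
      rfl
  have hleft : #{p ∈ T ×ˢ T | p.1 = x ∧ x + p.2 ∈ T} = #{a ∈ T | x + a ∈ T} := by
    refine card_bij' (fun p _ => p.2) (fun a _ => (x, a)) ?_ ?_ ?_ ?_
    · rintro ⟨a, b⟩ h
      simp only [mem_filter, mem_product] at h ⊢
      exact ⟨h.1.2, h.2.2⟩
    · intro a h
      simp only [mem_filter, mem_product] at h ⊢
      exact ⟨⟨hx, h.1⟩, trivial, h.2⟩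
    · rintro ⟨a, b⟩ h
      simp only [mem_filter] at h
      ext <;> simp [h.2.1]
    · intro a _
      rfl
  have hright : #{p ∈ T ×ˢ T | p.2 = x ∧ x + p.1 ∈ T} = #{a ∈ T | x + a ∈ T} := by
    refine card_bij' (fun p _ => p.1) (fun a _ => (a, x)) ?_ ?_ ?_ ?_
    · rintro ⟨a, b⟩ h
      simp only [mem_filter, mem_product] at h ⊢
      exact ⟨h.1.1, h.2.2⟩
    · intro a h
      simp only [mem_filter, mem_product] at h ⊢
      exact ⟨⟨h.1, hx⟩, trivial, h.2⟩
    · rintro ⟨a, b⟩ h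
      simp only [mem_filter] at h
      ext <;> simp [h.2.1]
    · intro a _
      rfl
  have hdiag : #{p ∈ T ×ˢ T | p = (x, x) ∧ 2 * x ∈ T} = if 2 * x ∈ T then 1 else 0 := by
    split_ifs with h
    · rw [card_eq_one]
      refine ⟨(x, x), ?_⟩
      ext p
      simp only [mem_filter, mem_product, mem_singleton, h, and_true]
      exact ⟨fun hp => hp.2, fun hp => by subst hp; exact ⟨⟨hx, hx⟩, rfl⟩⟩
    · simp [h]
  have herase : rval (T.erase x) =
      #{p ∈ T ×ˢ T | p.1 ≠ x ∧ p.2 ≠ x ∧ p.1 + p.2 ≠ x ∧ p.1 + p.2 ∈ T} := by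
    unfold rval
    congr 1
    ext p
    simp only [mem_filter, mem_product, mem_erase]
    tauto
  have hpair : 2 * #{a ∈ T | x + a ∈ T} =
      #{p ∈ T ×ˢ T | p.1 = x ∧ x + p.2 ∈ T} + #{p ∈ T ×ˢ T | p.2 = x ∧ x + p.1 ∈ T} := by
    rw [hleft, hright, two_mul]
  rw [← hdiag, ← hsum, hpair, herase]
  unfold rval
  simp only [card_filter, ← sum_add_distrib]
  refine sum_congr rfl ?_
  rintro ⟨a, b⟩ hp
  rw [mem_product] at hp
  have ha := hpos a hp.1
  have hb := hpos b hp.2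
  simp only [Prod.mk.injEq]
  by_cases h1 : a = x
  · subst h1
    by_cases h2 : b = a
    · subst h2
      by_cases h3 : b + b ∈ T <;> simp [h3, two_mul, hb.ne']
    · by_cases h3 : a + b ∈ T <;> simp [h2, h3, hb.ne']
  · by_cases h2 : b = x
    · subst h2
      by_cases h3 : b + a ∈ T <;> simp [h1, h3, ha.ne', add_comm a b]
    · by_cases h3 : a + b = x
      · simp [h1, h2, h3, hx]
      · simp [h1, h2, h3]

theorem choose_two_succ (d : ℕ) : (d + 1).choose 2 = d + d.choose 2 := by
  rw [Nat.choose_succ_succ' d 1, Nat.choose_one_right]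

open Finset in
theorem rval_Icc_s18 (m d : ℕ) : rval (Icc (m + 1) (2 * m + d)) = d.choose 2 := by
  induction d with
  | zero =>
    rw [rval, Nat.choose_zero_succ, card_eq_zero, filter_eq_empty_iff]
    rintro ⟨a, b⟩ h
    simp only [mem_product, mem_Icc] at h ⊢
    omega
  | succ d ih =>
    have h := rval_erase (T := Icc (m + 1) (2 * m + (d + 1))) (x := 2 * m + (d + 1))
      (by simp) (by simp; omega)
    have e1 : (Icc (m + 1) (2 * m + (d + 1))).erase (2 * m + (d + 1)) =
        Icc (m + 1) (2 * m + d) := by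
      ext a; simp only [mem_erase, mem_Icc]; omega
    have e2 : {a ∈ Icc (m + 1) (2 * m + (d + 1)) | a ≤ 2 * m + (d + 1) ∧
        2 * m + (d + 1) - a ∈ Icc (m + 1) (2 * m + (d + 1))} = Icc (m + 1) (m + d) := by
      ext a; simp only [mem_filter, mem_Icc]; omega
    have e3 : {a ∈ Icc (m + 1) (2 * m + (d + 1)) |
        2 * m + (d + 1) + a ∈ Icc (m + 1) (2 * m + (d + 1))} = ∅ := by
      ext a; simp only [mem_filter, mem_Icc, notMem_empty, iff_false]; omega
    have e4 : ¬ 2 * (2 * m + (d + 1)) ∈ Icc (m + 1) (2 * m + (d + 1)) := by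
      simp only [mem_Icc]; omega
    rw [e1, e2, e3, ih, if_neg e4, Nat.card_Icc, card_empty] at h
    rw [choose_two_succ]
    omega

open Finset in
/-- The value of `rval` on `[m + 1, 2m + d]` with `x` replaced by some `y ≤ m`. -/
theorem rval_swap {m d x y : ℕ} (hy : 1 ≤ y) (hym : y ≤ m) (hx : m + 1 ≤ x)
    (hxN : x ≤ 2 * m + d) :
    rval ((insert y (Icc (m + 1) (2 * m + d))).erase x) + (x - 1 - 2 * m) + 2 * (m + d - x)
      + (if m + 1 + y ≤ x then 2 else 0) + (if x = 2 * y then 1 else 0)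
      + (if x + y ≤ 2 * m + d then 2 else 0) =
    d.choose 2 + 2 * (m + d - y) + (if m + 1 ≤ 2 * y then 1 else 0)
      + (if 2 * x ≤ 2 * m + d then 1 else 0) := by
  set I := Icc (m + 1) (2 * m + d) with hI
  have hyI : y ∉ I := by simp only [hI, mem_Icc]; omega
  have h0 : 0 ∉ insert y I := by simp only [hI, mem_insert, mem_Icc]; omega
  have hy' := rval_erase h0 (mem_insert_self y I)
  have hx' := rval_erase h0 (x := x) (by simp only [hI, mem_insert, mem_Icc]; omega)
  rw [erase_insert hyI, rval_Icc_s18] at hy'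
  have a1 : {a ∈ insert y I | a ≤ y ∧ y - a ∈ insert y I} = ∅ := by
    ext a; simp only [hI, mem_filter, mem_insert, mem_Icc, notMem_empty, iff_false]; omega
  have a2 : #{a ∈ insert y I | y + a ∈ insert y I} =
      (if m + 1 ≤ 2 * y then 1 else 0) + (m + d - y) := by
    have : {a ∈ I | y + a ∈ insert y I} = Icc (m + 1) (2 * m + d - y) := by
      ext a; simp only [hI, mem_filter, mem_insert, mem_Icc]; omega
    rw [filter_insert, this]
    have hc : #(Icc (m + 1) (2 * m + d - y)) = m + d - y := by rw [Nat.card_Icc]; omega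
    have hmem : y + y ∈ insert y I ↔ m + 1 ≤ 2 * y := by
      simp only [hI, mem_insert, mem_Icc]; omega
    simp only [hmem]
    split_ifs
    · rw [card_insert_of_notMem (by simp only [mem_Icc]; omega), hc, add_comm]
    · rw [hc, zero_add]
  have a3 : (2 * y ∈ insert y I) ↔ m + 1 ≤ 2 * y := by
    simp only [hI, mem_insert, mem_Icc]; omega
  have b1 : #{a ∈ insert y I | a ≤ x ∧ x - a ∈ insert y I} =
      (x - 1 - 2 * m) + (if m + 1 + y ≤ x then 2 else 0) + (if x = 2 * y then 1 else 0) := by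
    have hc : #(Icc (m + 1) (x - 1 - m)) = x - 1 - 2 * m := by rw [Nat.card_Icc]; omega
    split_ifs with h1 h2 h2
    · omega
    · have : {a ∈ insert y I | a ≤ x ∧ x - a ∈ insert y I} =
          insert y (insert (x - y) (Icc (m + 1) (x - 1 - m))) := by
        ext a; simp only [hI, mem_filter, mem_insert, mem_Icc]; omega
      rw [this, card_insert_of_notMem, card_insert_of_notMem, hc]
      · simp only [mem_Icc]; omega
      · simp only [mem_insert, mem_Icc]; omega
    · have : {a ∈ insert y I | a ≤ x ∧ x - a ∈ insert y I} =
          insert y (Icc (m + 1) (x - 1 - m)) := by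
        ext a; simp only [hI, mem_filter, mem_insert, mem_Icc]; omega
      rw [this, card_insert_of_notMem, hc]
      · simp only [mem_Icc]; omega
    · have : {a ∈ insert y I | a ≤ x ∧ x - a ∈ insert y I} = Icc (m + 1) (x - 1 - m) := by
        ext a; simp only [hI, mem_filter, mem_insert, mem_Icc]; omega
      rw [this, hc, add_zero, add_zero]
  have b2 : #{a ∈ insert y I | x + a ∈ insert y I} =
      (if x + y ≤ 2 * m + d then 1 else 0) + (m + d - x) := by
    have : {a ∈ I | x + a ∈ insert y I} = Icc (m + 1) (2 * m + d - x) := by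
      ext a; simp only [hI, mem_filter, mem_insert, mem_Icc]; omega
    rw [filter_insert, this]
    have hc : #(Icc (m + 1) (2 * m + d - x)) = m + d - x := by rw [Nat.card_Icc]; omega
    have hmem : x + y ∈ insert y I ↔ x + y ≤ 2 * m + d := by
      simp only [hI, mem_insert, mem_Icc]; omega
    simp only [hmem]
    split_ifs
    · rw [card_insert_of_notMem (by simp only [mem_Icc]; omega), hc, add_comm]
    · rw [hc, zero_add]
  have b3 : (2 * x ∈ insert y I) ↔ 2 * x ≤ 2 * m + d := by
    simp only [hI, mem_insert, mem_Icc]; omega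
  rw [a1, a2, card_empty] at hy'
  rw [b1, b2] at hx'
  simp only [a3] at hy'
  simp only [b3] at hx'
  split_ifs at * <;> omega

open Finset in
/-- The value of `rval` on an initial interval with one element removed. -/
theorem rval_Icc_one_erase_s18 {s k : ℕ} (hk : 1 ≤ k) (hks : k ≤ s + 1) :
    rval ((Icc 1 (s + 1)).erase k) + s + 1 =
      s.choose 2 + k + (if 2 * k ≤ s + 1 then 1 else 0) := by
  have h := rval_erase (T := Icc 1 (s + 1)) (x := k) (by simp) (by simp [hk, hks])
  have e0 : rval (Icc 1 (s + 1)) = (s + 1).choose 2 := by simpa using rval_Icc_s18 0 (s + 1)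
  have e1 : {a ∈ Icc 1 (s + 1) | a ≤ k ∧ k - a ∈ Icc 1 (s + 1)} = Icc 1 (k - 1) := by
    ext a; simp only [mem_filter, mem_Icc]; omega
  have e2 : {a ∈ Icc 1 (s + 1) | k + a ∈ Icc 1 (s + 1)} = Icc 1 (s + 1 - k) := by
    ext a; simp only [mem_filter, mem_Icc]; omega
  have e3 : 2 * k ∈ Icc 1 (s + 1) ↔ 2 * k ≤ s + 1 := by simp only [mem_Icc]; omega
  rw [e0, e1, e2, Nat.card_Icc, Nat.card_Icc, choose_two_succ] at h
  simp only [e3] at h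
  split_ifs at * <;> omega

/-- `v` is the number of Schur pairs of some `s`-element subset of `[1, N]`. -/
def RvalAttained (s N v : ℕ) : Prop :=
  ∃ S : Finset ℕ, S ⊆ Finset.Icc 1 N ∧ S.card = s ∧ rval S = v

theorem RvalAttained.mono {s N N' v : ℕ} (h : RvalAttained s N v) (hN : N ≤ N') :
    RvalAttained s N' v := by
  obtain ⟨S, hS, hc, hr⟩ := h
  exact ⟨S, hS.trans (Finset.Icc_subset_Icc_right hN), hc, hr⟩

theorem rvalAttained_choose (m d : ℕ) : RvalAttained (m + d) (2 * m + d) (d.choose 2) :=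
  ⟨Finset.Icc (m + 1) (2 * m + d), Finset.Icc_subset_Icc_left (by omega),
    by rw [Nat.card_Icc]; omega, rval_Icc_s18 m d⟩

theorem rvalAttained_swap {m d t : ℕ} (x y : ℕ) (hy : 1 ≤ y) (hym : y ≤ m) (hx : m + 1 ≤ x)
    (hxN : x ≤ 2 * m + d)
    (ht : t + (x - 1 - 2 * m) + 2 * (m + d - x)
        + (if m + 1 + y ≤ x then 2 else 0) + (if x = 2 * y then 1 else 0)
        + (if x + y ≤ 2 * m + d then 2 else 0) =
      2 * (m + d - y) + (if m + 1 ≤ 2 * y then 1 else 0)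
        + (if 2 * x ≤ 2 * m + d then 1 else 0)) :
    RvalAttained (m + d) (2 * m + d) (d.choose 2 + t) := by
  refine ⟨(insert y (Finset.Icc (m + 1) (2 * m + d))).erase x, ?_, ?_, ?_⟩
  · intro a
    simp only [Finset.mem_erase, Finset.mem_insert, Finset.mem_Icc]
    omega
  · rw [Finset.card_erase_of_mem, Finset.card_insert_of_notMem, Nat.card_Icc]
    · omega
    · simp only [Finset.mem_Icc]; omega
    · simp only [Finset.mem_insert, Finset.mem_Icc]; omega
  · have := rval_swap hy hym hx hxN
    omega

theorem rvalAttained_of_lt {m d t : ℕ} (hm : 2 ≤ m) (ht : t < d)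
    (hodd : t % 2 = 1 → m ≤ t) : RvalAttained (m + d) (2 * m + d) (d.choose 2 + t) := by
  rcases Nat.eq_zero_or_pos t with rfl | ht0
  · exact rvalAttained_choose m d
  by_cases hlarge : 2 * m ≤ t
  · by_cases h : 2 * (t + 1 - m) ≤ d
    · apply rvalAttained_swap (t + 1) m <;> first | omega | (split_ifs <;> omega)
    · apply rvalAttained_swap (t + 2) m <;> first | omega | (split_ifs <;> omega)
  rcases Nat.mod_two_eq_zero_or_one t with he | ho
  · apply rvalAttained_swap (m + t / 2) m <;> first | omega | (split_ifs <;> omega)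
  · have := hodd ho
    apply rvalAttained_swap (t + 1 - (2 * m - 1 - t) / 2 * 2 + (2 * m - 1 - t))
      (m - (2 * m - 1 - t) / 2) <;> first | omega | (split_ifs <;> omega)

theorem rvalAttained_or_exceptional {m : ℕ} (hm : 1 ≤ m) : ∀ {d v : ℕ}, 2 ≤ d →
    d.choose 2 ≤ v → v ≤ (m + d).choose 2 →
    RvalAttained (m + d) (2 * m + d) v ∨
      ∃ i, 1 ≤ i ∧ 2 * i ≤ m ∧ 2 * i ≤ d ∧ v = d.choose 2 + (2 * i - 1) := by
  induction m, hm using Nat.le_induction with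
  | base =>
    intro d v hd hv1 hv2
    left
    have hch : (1 + d).choose 2 = d + d.choose 2 := by
      rw [add_comm, choose_two_succ]
    have key : ∀ k, 1 ≤ k → k ≤ d + 2 →
        v + (1 + d) + 1 = (1 + d).choose 2 + k + (if 2 * k ≤ (1 + d) + 1 then 1 else 0) →
        RvalAttained (1 + d) (2 * 1 + d) v := by
      intro k hk1 hk2 hk
      have := rval_Icc_one_erase_s18 (s := 1 + d) hk1 (by omega)
      refine ⟨(Finset.Icc 1 (1 + d + 1)).erase k, ?_, ?_, by omega⟩
      · exact (Finset.erase_subset _ _).trans (Finset.Icc_subset_Icc_right (by omega))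
      · rw [Finset.card_erase_of_mem (by simp only [Finset.mem_Icc]; omega), Nat.card_Icc]
        omega
    by_cases h : 2 * (v - d.choose 2 + 1) ≤ d + 2
    · apply key (v - d.choose 2 + 1) <;> first | omega | (split_ifs <;> omega)
    · apply key (v - d.choose 2 + 2) <;> first | omega | (split_ifs <;> omega)
  | succ m hm ih =>
    intro d v hd hv1 hv2
    have hch := choose_two_succ d
    obtain ⟨t, rfl⟩ := Nat.exists_eq_add_of_le hv1
    by_cases ht : t < d
    · by_cases hodd : t % 2 = 1 → m + 1 ≤ t
      · exact .inl (rvalAttained_of_lt (by omega) ht hodd)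
      · push Not at hodd
        exact .inr ⟨(t + 1) / 2, by omega, by omega, by omega, by omega⟩
    left
    have hs : m + 1 + d = m + (d + 1) := by omega
    rcases ih (d := d + 1) (v := d.choose 2 + t) (by omega) (by omega) (hs ▸ hv2) with h | h
    · rw [hs]
      exact h.mono (by omega)
    · obtain ⟨i, hi, him, hid, hiv⟩ := h
      obtain rfl : t = d + (2 * i - 1) := by omega
      by_cases hlt : 2 * i - 1 < d
      · apply rvalAttained_swap (2 * (m + 1) + d - (2 * i - 1)) (m + 1) <;>
          first | omega | (split_ifs <;> omega)
      · apply rvalAttained_swap (2 * (m + 1)) (m + 1) <;> first | omega | (split_ifs <;> omega)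

/-- Theorem 5.8: for `s + 2 ≤ N ≤ 2s − 2`, any unattained value `v` in
`[f_{s,N}, g_{s,N}]` (with `f_{s,N} = (2s−N)(2s−N−1)/2`, `g_{s,N} = s(s−1)/2`) is of
the form `f_{s,N} + (2i − 1)` with `1 ≤ i ≤ min(s − ⌈N/2⌉, ⌊(N−s)/2⌋)`. -/
theorem exceptional_values_form (s N : ℕ) (hs : 0 < s) (h1 : s + 2 ≤ N)
    (h2 : N ≤ 2 * s - 2) (v : ℕ)
    (hv1 : (2 * s - N) * (2 * s - N - 1) / 2 ≤ v) (hv2 : v ≤ s * (s - 1) / 2)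
    (hnot : ¬ ∃ S : Finset ℕ, S ⊆ Finset.Icc 1 N ∧ S.card = s ∧ rval S = v) :
    ∃ i : ℕ, 1 ≤ i ∧ i ≤ min (s - (N + 1) / 2) ((N - s) / 2) ∧
      v = (2 * s - N) * (2 * s - N - 1) / 2 + (2 * i - 1) := by
  rw [← Nat.choose_two_right] at hv1 hv2 ⊢
  have hsd : s = (N - s) + (2 * s - N) := by omega
  have hNd : N = 2 * (N - s) + (2 * s - N) := by omega
  rcases rvalAttained_or_exceptional (m := N - s) (by omega) (d := 2 * s - N) (by omega) hv1
    (hsd ▸ hv2) with h | ⟨i, hi, him, hid, hiv⟩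
  · rw [← hsd, ← hNd] at h
    exact absurd h hnot
  · exact ⟨i, hi, by omega, hiv⟩
end
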